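/- arXiv:0709.0988 — 3 statements merged into one kernel-verified Lean document; each statement's English description precedes it below -/
import Mathlib

section
/- Let d ≥ 1, let S be a finite abstract simplicial complex with ‖S‖ homeomorphic to S^d, and let f : ‖S‖ → ℝ^d be a continuous map in general position, meaning that f(‖σ‖) ∩ f(‖τ‖) = ∅ for all faces σ, τ of S with σ ∩ τ = ∅ and dim σ + dim τ < d. Then there exist faces σ, τ of S with σ ∩ τ = ∅, dim σ + dim τ = d, and f(‖σ‖) ∩ f(‖τ‖) ≠ ∅. -/
/-- An abstract simplicial complex on vertex type `V`: a collection of nonempty finite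
sets (the faces) closed under passing to nonempty subsets. -/
def IsComplex {V : Type} [DecidableEq V] (K : Finset (Finset V)) : Prop :=
  (∀ σ ∈ K, σ.Nonempty) ∧ ∀ σ ∈ K, ∀ τ : Finset V, τ ⊆ σ → τ.Nonempty → τ ∈ K

/-- The geometric realization `‖K‖` of an abstract simplicial complex `K`. -/
def GeomRep {V : Type} [Fintype V] (K : Finset (Finset V)) : Type :=
  {x : V → ℝ // (∀ v, 0 ≤ x v) ∧ (∀ v, x v ≤ 1) ∧ (∑ v, x v) = 1 ∧
    (Finset.univ.filter fun v => x v ≠ 0) ∈ K}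

instance {V : Type} [Fintype V] (K : Finset (Finset V)) : TopologicalSpace (GeomRep K) :=
  instTopologicalSpaceSubtype

/-- The support of a point of the realization. -/
noncomputable def ptSupport {V : Type} [Fintype V] {K : Finset (Finset V)} (x : GeomRep K) : Finset V :=
  Finset.univ.filter fun v => x.1 v ≠ 0

section AdaptedBasis

open MvPolynomial

/-- The products `∏ i, g i ^ (k i / e i) * X i ^ (k i % e i)`; when `g i` has leading monomial
`X i ^ e i`, they form a basis of the polynomial ring adapted to the ideal generated by `g`. -/
noncomputable def adaptedMonomial {σ : Type*} [Fintype σ] (e : σ → ℕ) (g : σ → MvPolynomial σ ℝ)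
    (k : σ →₀ ℕ) : MvPolynomial σ ℝ :=
  ∏ i, g i ^ (k i / e i) * X i ^ (k i % e i)

variable {σ : Type*} [Fintype σ] {m : MonomialOrder σ} {e : σ → ℕ} {g : σ → MvPolynomial σ ℝ}

theorem adaptedMonomial_leading (hg : ∀ i, m.Monic (g i))
    (hdeg : ∀ i, m.degree (g i) = Finsupp.single i (e i)) (k : σ →₀ ℕ) :
    m.Monic (adaptedMonomial e g k) ∧ m.degree (adaptedMonomial e g k) = k := by
  classical
  have hX : ∀ i : σ, m.Monic (X i : MvPolynomial σ ℝ) := fun i => m.monic_X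
  have hne : ∀ i, g i ^ (k i / e i) * X i ^ (k i % e i) ≠ 0 := fun i =>
    mul_ne_zero (pow_ne_zero _ (hg i).ne_zero) (pow_ne_zero _ (hX i).ne_zero)
  constructor
  · exact MonomialOrder.Monic.prod fun i _ => (hg i).pow.mul (hX i).pow
  · rw [adaptedMonomial, m.degree_prod (fun i _ => hne i)]
    have : ∀ i, m.degree (g i ^ (k i / e i) * X i ^ (k i % e i)) = Finsupp.single i (k i) := by
      intro i
      rw [m.degree_mul (pow_ne_zero _ (hg i).ne_zero) (pow_ne_zero _ (hX i).ne_zero),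
        m.degree_pow, m.degree_pow, hdeg, m.degree_X, Finsupp.smul_single, Finsupp.smul_single,
        ← Finsupp.single_add]
      congr 1
      simp only [smul_eq_mul, mul_one]
      rw [mul_comm]
      exact Nat.div_add_mod _ _
    rw [Finset.sum_congr rfl fun i _ => this i]
    exact Finsupp.univ_sum_single k

theorem linearIndependent_adaptedMonomial (hg : ∀ i, m.Monic (g i))
    (hdeg : ∀ i, m.degree (g i) = Finsupp.single i (e i)) :
    LinearIndependent ℝ (adaptedMonomial e g) := by
  classical
  rw [linearIndependent_iff]
  intro l hl
  by_contra hne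
  obtain ⟨k, hk, hmax⟩ := l.support.exists_max_image m.toSyn (Finsupp.support_nonempty_iff.2 hne)
  have hcoeff := congrArg (coeff k) hl
  rw [Finsupp.linearCombination_apply, Finsupp.sum, coeff_sum, Finset.sum_eq_single k] at hcoeff
  · have h1 := adaptedMonomial_leading hg hdeg k
    have h2 := h1.1.coeff_degree
    rw [h1.2] at h2
    rw [coeff_smul, h2, coeff_zero, smul_eq_mul, mul_one] at hcoeff
    exact Finsupp.mem_support_iff.1 hk hcoeff
  · intro j hj hjk
    rw [coeff_smul, m.coeff_eq_zero_of_lt, smul_zero]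
    rw [(adaptedMonomial_leading hg hdeg j).2]
    exact lt_of_le_of_ne (hmax j hj) fun h => hjk (m.toSyn.injective h)
  · exact fun h => absurd hk h

theorem span_adaptedMonomial (hg : ∀ i, m.Monic (g i))
    (hdeg : ∀ i, m.degree (g i) = Finsupp.single i (e i)) :
    Submodule.span ℝ (Set.range (adaptedMonomial e g)) = ⊤ := by
  classical
  rw [eq_top_iff]
  rintro p -
  induction hs : m.toSyn (m.degree p) using WellFoundedLT.induction generalizing p with
  | _ s ih =>
  by_cases hp : p = 0
  · rw [hp]; exact zero_mem _
  set k := m.degree p with hk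
  obtain ⟨h1, h2⟩ := adaptedMonomial_leading hg hdeg k
  have hmem : adaptedMonomial e g k ∈ Submodule.span ℝ (Set.range (adaptedMonomial e g)) :=
    Submodule.subset_span ⟨k, rfl⟩
  set p' := p - m.leadingCoeff p • adaptedMonomial e g k with hp'
  have hsum : p = p' + m.leadingCoeff p • adaptedMonomial e g k := by rw [hp']; ring
  rw [hsum]
  refine add_mem ?_ (Submodule.smul_mem _ _ hmem)
  by_cases hp0 : p' = 0
  · rw [hp0]; exact zero_mem _
  refine ih (m.toSyn (m.degree p')) ?_ rfl
  rw [← hs]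
  refine lt_of_le_of_ne ?_ fun h => ?_
  · refine le_trans m.degree_sub_le (max_le le_rfl ?_)
    exact (m.degree_smul_le).trans (by rw [h2])
  · have h3 := m.toSyn.injective h
    have h4 : coeff k p' = 0 := by
      have h5 := h1.coeff_degree
      rw [h2] at h5
      rw [hp', coeff_sub, coeff_smul, h5, smul_eq_mul, mul_one, MonomialOrder.leadingCoeff, hk,
        sub_self]
    rw [← h3] at h4
    exact hp0 (m.coeff_degree_eq_zero_iff.1 h4)

/-- The basis of the polynomial ring formed by the adapted monomials. -/
noncomputable def adaptedBasis (hg : ∀ i, m.Monic (g i))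
    (hdeg : ∀ i, m.degree (g i) = Finsupp.single i (e i)) :
    Module.Basis (σ →₀ ℕ) ℝ (MvPolynomial σ ℝ) :=
  Module.Basis.mk (linearIndependent_adaptedMonomial hg hdeg) (span_adaptedMonomial hg hdeg).ge

theorem adaptedBasis_apply (hg : ∀ i, m.Monic (g i))
    (hdeg : ∀ i, m.degree (g i) = Finsupp.single i (e i)) (k : σ →₀ ℕ) :
    adaptedBasis hg hdeg k = adaptedMonomial e g k :=
  Module.Basis.mk_apply _ _ _

theorem mul_adaptedMonomial (he : ∀ i, 0 < e i) (i : σ) (k : σ →₀ ℕ) :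
    g i * adaptedMonomial e g k = adaptedMonomial e g (k + Finsupp.single i (e i)) := by
  classical
  unfold adaptedMonomial
  rw [← Finset.mul_prod_erase Finset.univ _ (Finset.mem_univ i),
    ← Finset.mul_prod_erase Finset.univ (fun j => g j ^ ((k + Finsupp.single i (e i)) j / e j) *
      X j ^ ((k + Finsupp.single i (e i)) j % e j)) (Finset.mem_univ i)]
  have : ∀ j ∈ Finset.univ.erase i, (k + Finsupp.single i (e i)) j = k j := by
    intro j hj
    simp [(Finset.ne_of_mem_erase hj).symm]
  rw [← mul_assoc]
  congr 1
  · simp only [Finsupp.add_apply, Finsupp.single_eq_same, Nat.add_div_right _ (he i),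
      Nat.add_mod_right]
    ring
  · exact Finset.prod_congr rfl fun j hj => by rw [this j hj]

/-- Membership in the ideal generated by `g` is read off the coordinates in the adapted basis. -/
theorem mem_span_range_iff_adaptedBasis_repr (he : ∀ i, 0 < e i) (hg : ∀ i, m.Monic (g i))
    (hdeg : ∀ i, m.degree (g i) = Finsupp.single i (e i)) (p : MvPolynomial σ ℝ) :
    p ∈ Ideal.span (Set.range g) ↔
      ∀ k : σ →₀ ℕ, (∀ i, k i < e i) → (adaptedBasis hg hdeg).repr p k = 0 := by
  classical
  set B := adaptedBasis hg hdeg with hB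
  constructor
  · intro hp k hk
    obtain ⟨c, rfl⟩ := Ideal.mem_span_range_iff_exists_fun.1 hp
    rw [map_sum, Finsupp.finsetSum_apply]
    refine Finset.sum_eq_zero fun i _ => ?_
    have hzero : Finsupp.lapply k ∘ₗ B.repr.toLinearMap ∘ₗ LinearMap.mulLeft ℝ (g i) = 0 := by
      refine B.ext fun j => ?_
      rw [LinearMap.comp_apply, LinearMap.comp_apply, LinearMap.mulLeft_apply, hB,
        adaptedBasis_apply, mul_adaptedMonomial he, ← adaptedBasis_apply hg hdeg, ← hB]
      simp only [LinearEquiv.coe_coe, B.repr_self, Finsupp.lapply_apply, LinearMap.zero_apply]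
      rw [Finsupp.single_eq_of_ne]
      rintro rfl
      simpa using hk i
    have := LinearMap.congr_fun hzero (c i)
    rw [mul_comm]
    simpa using this
  · intro h
    rw [← B.linearCombination_repr p, Finsupp.linearCombination_apply, Finsupp.sum]
    refine Ideal.sum_mem _ fun k _ => ?_
    by_cases hk : ∀ i, k i < e i
    · rw [h k hk, zero_smul]; exact zero_mem _
    · push Not at hk
      obtain ⟨i, hi⟩ := hk
      have : k = (k - Finsupp.single i (e i)) + Finsupp.single i (e i) := by
        ext j
        by_cases hj : i = j
        · subst hj; simp [Nat.sub_add_cancel hi]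
        · simp [hj]
      rw [hB, adaptedBasis_apply, this, ← mul_adaptedMonomial he, smul_eq_C_mul]
      exact Ideal.mul_mem_left _ _ (Ideal.mul_mem_right _ _ (Ideal.subset_span ⟨i, rfl⟩))

end AdaptedBasis

theorem exists_algHom_real_of_odd_finrank_module {A : Type*} [CommRing A] [Algebra ℝ A]
    (n : ℕ) : ∀ (E : Type*) [AddCommGroup E] [Module ℝ E] [Module A E] [IsScalarTower ℝ A E]
    [FiniteDimensional ℝ E], Module.finrank ℝ E = n → Odd n → Nonempty (A →ₐ[ℝ] ℝ) := by
  induction n using Nat.strong_induction_on with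
  | _ n ih =>
  intro E _ _ _ _ _ hn hodd
  have : Nontrivial E := Module.nontrivial_of_finrank_pos (R := ℝ) (by rw [hn]; exact hodd.pos)
  have : IsArtinian A E := isArtinian_of_tower ℝ inferInstance
  obtain ⟨S, hS⟩ := IsAtomic.exists_atom (Submodule A E)
  have hsimple : IsSimpleModule A S := isSimpleModule_iff_isAtom.2 hS
  obtain ⟨I, hI, ⟨e⟩⟩ := isSimpleModule_iff_quot_maximal.1 hsimple
  let _ : Field (A ⧸ I) := Ideal.Quotient.field I
  let eR : S ≃ₗ[ℝ] A ⧸ I := e.restrictScalars ℝ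
  have : FiniteDimensional ℝ S := inferInstanceAs (FiniteDimensional ℝ (S.restrictScalars ℝ))
  have : FiniteDimensional ℝ (A ⧸ I) := Module.Finite.equiv eR
  rcases Real.nonempty_algEquiv_or (A ⧸ I) with ⟨⟨φ⟩⟩ | ⟨⟨φ⟩⟩
  · exact ⟨φ.toAlgHom.comp (Ideal.Quotient.mkₐ ℝ I)⟩
  · have h2 : Module.finrank ℝ S = 2 := by
      rw [eR.finrank_eq, φ.toLinearEquiv.finrank_eq, Complex.finrank_real_complex]
    have hq : Module.finrank ℝ (E ⧸ S) + Module.finrank ℝ S = Module.finrank ℝ E :=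
      Submodule.finrank_quotient_add_finrank (S.restrictScalars ℝ)
    have : FiniteDimensional ℝ (E ⧸ S) :=
      inferInstanceAs (FiniteDimensional ℝ (E ⧸ S.restrictScalars ℝ))
    refine ih (n - 2) (by have := hodd.pos; omega) (E ⧸ S) (by omega) ?_
    obtain ⟨k, hk⟩ := hodd
    exact ⟨k - 1, by omega⟩

/-- An algebra over `ℝ` of odd finite dimension has a real character. -/
theorem exists_algHom_real_of_odd_finrank {A : Type*} [CommRing A] [Algebra ℝ A]
    (h : Odd (Module.finrank ℝ A)) : Nonempty (A →ₐ[ℝ] ℝ) := by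
  have : FiniteDimensional ℝ A := FiniteDimensional.of_finrank_pos h.pos
  exact exists_algHom_real_of_odd_finrank_module _ A rfl h

section Parity

open MvPolynomial

variable {σ : Type*} [Fintype σ] {m : MonomialOrder σ} {e : σ → ℕ} {g : σ → MvPolynomial σ ℝ}

/-- The substitution `X i ↦ -X i`. -/
noncomputable def antipode (σ : Type*) : MvPolynomial σ ℝ →ₐ[ℝ] MvPolynomial σ ℝ :=
  aeval fun i => -X i

@[simp]
theorem antipode_X {σ : Type*} (i : σ) : antipode σ (X i) = -X i := by
  simp [antipode]

@[simp]
theorem antipode_antipode {σ : Type*} (p : MvPolynomial σ ℝ) :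
    antipode σ (antipode σ p) = p := by
  have : (antipode σ).comp (antipode σ) = AlgHom.id ℝ _ := by
    ext i; simp
  exact DFunLike.congr_fun this p

theorem eval_antipode {σ : Type*} (v : σ → ℝ) (p : MvPolynomial σ ℝ) :
    eval v (antipode σ p) = eval (-v) p := by
  have : (aeval v : MvPolynomial σ ℝ →ₐ[ℝ] ℝ).comp (antipode σ) = aeval (-v) := by
    ext i; simp
  simpa [aeval_eq_eval] using DFunLike.congr_fun this p

/-- The algebra of even polynomials. -/
noncomputable def evenPolynomials (σ : Type*) : Subalgebra ℝ (MvPolynomial σ ℝ) :=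
  AlgHom.equalizer (antipode σ) (AlgHom.id ℝ _)

theorem mem_evenPolynomials {σ : Type*} {p : MvPolynomial σ ℝ} :
    p ∈ evenPolynomials σ ↔ antipode σ p = p := by
  simp [evenPolynomials]

theorem antipode_adaptedMonomial (hpar : ∀ i, antipode σ (g i) = (-1) ^ e i * g i)
    (k : σ →₀ ℕ) :
    antipode σ (adaptedMonomial e g k) = (-1) ^ (∑ i, k i) * adaptedMonomial e g k := by
  unfold adaptedMonomial
  rw [map_prod, ← Finset.prod_pow_eq_pow_sum, ← Finset.prod_mul_distrib]
  refine Finset.prod_congr rfl fun i _ => ?_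
  rw [map_mul, map_pow, map_pow, hpar, antipode_X, neg_pow (X i : MvPolynomial σ ℝ),
    mul_pow, ← pow_mul]
  conv_rhs => rw [← Nat.div_add_mod (k i) (e i), pow_add, Nat.div_add_mod]
  ring

theorem adaptedBasis_repr_antipode (hg : ∀ i, m.Monic (g i))
    (hdeg : ∀ i, m.degree (g i) = Finsupp.single i (e i))
    (hpar : ∀ i, antipode σ (g i) = (-1) ^ e i * g i) (p : MvPolynomial σ ℝ) (k : σ →₀ ℕ) :
    (adaptedBasis hg hdeg).repr (antipode σ p) k =
      (-1) ^ (∑ i, k i) * (adaptedBasis hg hdeg).repr p k := by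
  set B := adaptedBasis hg hdeg with hB
  have : Finsupp.lapply k ∘ₗ B.repr.toLinearMap ∘ₗ (antipode σ).toLinearMap =
      ((-1 : ℝ) ^ (∑ i, k i)) • (Finsupp.lapply k ∘ₗ B.repr.toLinearMap) := by
    refine B.ext fun j => ?_
    have hj : antipode σ (B j) = ((-1 : ℝ) ^ (∑ i, j i)) • B j := by
      rw [hB, adaptedBasis_apply, antipode_adaptedMonomial hpar, smul_eq_C_mul]
      simp
    simp only [LinearMap.comp_apply, AlgHom.toLinearMap_apply, hj, map_smul, LinearMap.smul_apply,
      LinearEquiv.coe_coe, B.repr_self, Finsupp.lapply_apply]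
    by_cases h : j = k
    · rw [h]
    · simp [Finsupp.single_eq_of_ne (Ne.symm h)]
  simpa using LinearMap.congr_fun this p

/-- The ideal of the even subalgebra cut out by the ideal generated by `g`. -/
noncomputable def evenIdeal (g : σ → MvPolynomial σ ℝ) : Ideal (evenPolynomials σ) :=
  (Ideal.span (Set.range g)).comap (evenPolynomials σ).val

theorem finrank_evenPolynomials_quotient [DecidableEq σ] (he : ∀ i, 0 < e i)
    (hg : ∀ i, m.Monic (g i))
    (hdeg : ∀ i, m.degree (g i) = Finsupp.single i (e i))
    (hpar : ∀ i, antipode σ (g i) = (-1) ^ e i * g i) :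
    Module.finrank ℝ (evenPolynomials σ ⧸ evenIdeal g) =
      Fintype.card {b : (i : σ) → Fin (e i) // Even (∑ i, (b i : ℕ))} := by
  set B := adaptedBasis hg hdeg with hB
  let T := {b : (i : σ) → Fin (e i) // Even (∑ i, (b i : ℕ))}
  let u : T → σ →₀ ℕ := fun b => Finsupp.equivFunOnFinite.symm fun i => (b.1 i : ℕ)
  have hu : Function.Injective u := by
    intro b c h
    apply Subtype.ext
    funext i
    exact Fin.ext (by simpa [u] using DFunLike.congr_fun h i)
  let L : evenPolynomials σ →ₗ[ℝ] (T → ℝ) :=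
    LinearMap.pi fun b => Finsupp.lapply (u b) ∘ₗ B.repr.toLinearMap ∘ₗ
      (evenPolynomials σ).val.toLinearMap
  have hL : ∀ p b, L p b = B.repr (p : MvPolynomial σ ℝ) (u b) := fun p b => rfl
  have hmem : ∀ b : T, B (u b) ∈ evenPolynomials σ := by
    intro b
    rw [mem_evenPolynomials, hB, adaptedBasis_apply, antipode_adaptedMonomial hpar,
      Even.neg_one_pow (by simpa [u] using b.2), one_mul]
  have hsurj : Function.Surjective L := by
    intro c
    refine ⟨∑ b, c b • ⟨B (u b), hmem b⟩, ?_⟩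
    funext b
    rw [hL]
    simp only [AddSubmonoidClass.coe_finsetSum, SetLike.val_smul, map_sum, map_smul,
      B.repr_self, Finsupp.finsetSum_apply, Finsupp.smul_apply, smul_eq_mul]
    rw [Finset.sum_eq_single b]
    · rw [Finsupp.single_eq_same, mul_one]
    · intro c _ hc
      rw [Finsupp.single_eq_of_ne (hu.ne hc.symm), mul_zero]
    · exact fun h => absurd (Finset.mem_univ b) h
  have hker : (evenIdeal g).restrictScalars ℝ = LinearMap.ker L := by
    ext p
    rw [Submodule.restrictScalars_mem, LinearMap.mem_ker, evenIdeal, Ideal.mem_comap,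
      mem_span_range_iff_adaptedBasis_repr he hg hdeg]
    constructor
    · intro h
      funext b
      exact h (u b) fun i => (b.1 i).2
    · intro h k hk
      rcases Nat.even_or_odd (∑ i, k i) with hev | hodd
      · have hk' : u ⟨fun i => ⟨k i, hk i⟩, hev⟩ = k := by ext i; rfl
        rw [← hk']
        exact congrFun h ⟨fun i => ⟨k i, hk i⟩, hev⟩
      · have := adaptedBasis_repr_antipode hg hdeg hpar p.1 k
        rw [mem_evenPolynomials.1 p.2, hodd.neg_one_pow] at this
        change (adaptedBasis hg hdeg).repr p.1 k = 0
        linarith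
  rw [← (Submodule.Quotient.restrictScalarsEquiv ℝ (evenIdeal g)).finrank_eq, hker,
    (L.quotKerEquivOfSurjective hsurj).finrank_eq, Module.finrank_fintype_fun_eq_card]

theorem odd_card_even_box [DecidableEq σ] {e : σ → ℕ} (i₀ : σ) (h2 : e i₀ = 2)
    (hodd : ∀ i ≠ i₀, Odd (e i)) :
    Odd (Fintype.card {b : (i : σ) → Fin (e i) // Even (∑ i, (b i : ℕ))}) := by
  have hsign : ∑ b : (i : σ) → Fin (e i), (-1 : ℤ) ^ (∑ i, (b i : ℕ)) = 0 := by
    simp_rw [← Finset.prod_pow_eq_pow_sum]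
    rw [← Fintype.prod_sum fun (i : σ) (j : Fin (e i)) => (-1 : ℤ) ^ (j : ℕ)]
    refine Finset.prod_eq_zero (Finset.mem_univ i₀) ?_
    rw [Fin.sum_univ_eq_sum_range (fun j => (-1 : ℤ) ^ j), h2]
    simp [Finset.sum_range_succ]
  have htot : ∑ b : (i : σ) → Fin (e i), ((1 : ℤ) + (-1) ^ (∑ i, (b i : ℕ))) =
      2 * ∏ i ∈ Finset.univ.erase i₀, (e i : ℤ) := by
    rw [Finset.sum_add_distrib, hsign, add_zero, Finset.sum_const, Finset.card_univ,
      Fintype.card_pi, ← Finset.mul_prod_erase Finset.univ _ (Finset.mem_univ i₀)]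
    simp [h2]
  have heven : ∑ b : (i : σ) → Fin (e i), ((1 : ℤ) + (-1) ^ (∑ i, (b i : ℕ))) =
      2 * (Fintype.card {b : (i : σ) → Fin (e i) // Even (∑ i, (b i : ℕ))} : ℤ) := by
    rw [Fintype.card_subtype, Finset.card_filter, Nat.cast_sum, Finset.mul_sum]
    refine Finset.sum_congr rfl fun b _ => ?_
    by_cases h : Even (∑ i, (b i : ℕ))
    · rw [h.neg_one_pow, if_pos h]; norm_num
    · rw [(Nat.not_even_iff_odd.1 h).neg_one_pow, if_neg h]; norm_num
  have hcard : (Fintype.card {b : (i : σ) → Fin (e i) // Even (∑ i, (b i : ℕ))} : ℤ) =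
      ∏ i ∈ Finset.univ.erase i₀, (e i : ℤ) := by linarith
  rw [← Nat.cast_prod, Nat.cast_inj] at hcard
  rw [hcard]
  exact Finset.prod_induction _ Odd (fun _ _ => Odd.mul) odd_one
    fun i hi => hodd i (Finset.ne_of_mem_erase hi)

end Parity

section RealPoint

open MvPolynomial

variable {σ : Type*}

theorem mul_mem_evenPolynomials_of_odd {p q : MvPolynomial σ ℝ} (hp : antipode σ p = -p)
    (hq : antipode σ q = -q) : p * q ∈ evenPolynomials σ := by
  rw [mem_evenPolynomials, map_mul, hp, hq, neg_mul_neg]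

/-- A real character of the algebra of even polynomials with positive value at some `X j * X j`
is evaluation at a real point. -/
theorem exists_eval_eq_of_evenPolynomials_character (φ : evenPolynomials σ →ₐ[ℝ] ℝ) (j : σ)
    (hpos : 0 < φ ⟨X j * X j, mul_mem_evenPolynomials_of_odd (antipode_X j) (antipode_X j)⟩) :
    ∃ v : σ → ℝ, (∀ p : evenPolynomials σ, eval v (p : MvPolynomial σ ℝ) = φ p) ∧
      ∀ (p : MvPolynomial σ ℝ) (hp : antipode σ p = -p),
        φ ⟨X j * p, mul_mem_evenPolynomials_of_odd (antipode_X j) hp⟩ = 0 → eval v p = 0 := by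
  set Y : evenPolynomials σ :=
    ⟨X j * X j, mul_mem_evenPolynomials_of_odd (antipode_X j) (antipode_X j)⟩ with hY
  set s := Real.sqrt (φ Y) with hs
  have hs0 : s ≠ 0 := (Real.sqrt_pos.2 hpos).ne'
  have hss : s * s = φ Y := Real.mul_self_sqrt hpos.le
  have hhalf : (C (1 / 2) : MvPolynomial σ ℝ) * 2 = 1 := by
    rw [← map_ofNat (C : ℝ →+* MvPolynomial σ ℝ) 2, ← C_mul]
    norm_num
  have hC : ∀ r : ℝ, antipode σ (C r) = C r := fun r => (antipode σ).commutes r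
  let E : MvPolynomial σ ℝ → evenPolynomials σ := fun p =>
    ⟨C (1 / 2) * (p + antipode σ p), by
      rw [mem_evenPolynomials, map_mul, map_add, hC, antipode_antipode, add_comm p]⟩
  let O : MvPolynomial σ ℝ → evenPolynomials σ := fun p =>
    ⟨X j * (C (1 / 2) * (p - antipode σ p)), by
      rw [mem_evenPolynomials, map_mul, map_mul, map_sub, hC, antipode_antipode, antipode_X]
      ring⟩
  have hEmul : ∀ p q, Y * E (p * q) = Y * (E p * E q) + O p * O q := by
    intro p q
    apply Subtype.ext
    simp only [hY, E, O, MulMemClass.coe_mul, AddMemClass.coe_add, map_mul]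
    linear_combination (-X j * X j * C (1 / 2) * (p * q + antipode σ p * antipode σ q)) * hhalf
  have hOmul : ∀ p q, O (p * q) = E p * O q + O p * E q := by
    intro p q
    apply Subtype.ext
    simp only [E, O, MulMemClass.coe_mul, AddMemClass.coe_add, map_mul]
    linear_combination (-X j * C (1 / 2) * (p * q - antipode σ p * antipode σ q)) * hhalf
  have hEadd : ∀ p q, E (p + q) = E p + E q := by
    intro p q
    apply Subtype.ext
    simp only [E, AddMemClass.coe_add, map_add]
    ring
  have hOadd : ∀ p q, O (p + q) = O p + O q := by
    intro p q
    apply Subtype.ext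
    simp only [O, AddMemClass.coe_add, map_add]
    ring
  have hEeven : ∀ p : evenPolynomials σ, E p = p := by
    intro p
    apply Subtype.ext
    simp only [E, mem_evenPolynomials.1 p.2]
    linear_combination (p : MvPolynomial σ ℝ) * hhalf
  have hOeven : ∀ p : evenPolynomials σ, O p = 0 := by
    intro p
    apply Subtype.ext
    simp only [O, mem_evenPolynomials.1 p.2, sub_self, mul_zero, ZeroMemClass.coe_zero]
  let ψ : MvPolynomial σ ℝ →+* ℝ :=
    { toFun := fun p => φ (E p) + φ (O p) / s
      map_one' := by
        have h1 := hEeven 1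
        have h2 := hOeven 1
        rw [OneMemClass.coe_one] at h1 h2
        simp [h1, h2]
      map_zero' := by
        have h1 := hEeven 0
        have h2 := hOeven 0
        rw [ZeroMemClass.coe_zero] at h1 h2
        simp [h1, h2]
      map_add' := fun p q => by
        rw [hEadd, hOadd, map_add, map_add]
        ring
      map_mul' := fun p q => by
        have h1 := congrArg φ (hEmul p q)
        simp only [map_add, map_mul, ← hss] at h1
        rw [hOmul, map_add, map_mul, map_mul]
        field_simp
        linear_combination h1 }
  have hψ : ∀ p, ψ p = eval (fun i => ψ (X i)) p := by
    intro p
    have : ψ = eval (fun i => ψ (X i)) := by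
      refine MvPolynomial.ringHom_ext (fun r => ?_) fun i => by rw [eval_X]
      have h3 : (C r : MvPolynomial σ ℝ) = (algebraMap ℝ (evenPolynomials σ) r) := rfl
      change φ (E (C r)) + φ (O (C r)) / s = _
      rw [eval_C, h3, hEeven, hOeven, φ.commutes]
      simp
    exact DFunLike.congr_fun this p
  refine ⟨fun i => ψ (X i), fun p => ?_, fun p hp h0 => ?_⟩
  · rw [← hψ]
    change φ (E p) + φ (O p) / s = _
    rw [hEeven, hOeven]
    simp
  · rw [← hψ]
    change φ (E p) + φ (O p) / s = _
    have hE0 : E p = 0 := by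
      apply Subtype.ext
      simp [E, hp]
    have hO0 : O p = ⟨X j * p, mul_mem_evenPolynomials_of_odd (antipode_X j) hp⟩ := by
      apply Subtype.ext
      simp only [O, hp]
      linear_combination (X j * p) * hhalf
    rw [hE0, hO0, h0]
    simp

/-- A system consisting of the sphere equation and odd equations with leading monomials
`X i ^ e i`, `e i` odd, has a real solution. -/
theorem exists_common_zero [Fintype σ] {m : MonomialOrder σ} {e : σ → ℕ}
    {g : σ → MvPolynomial σ ℝ} (hg : ∀ i, m.Monic (g i))
    (hdeg : ∀ i, m.degree (g i) = Finsupp.single i (e i)) (i₀ : σ) (h2 : e i₀ = 2)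
    (hodd : ∀ i ≠ i₀, Odd (e i)) (hsphere : g i₀ = ∑ i, X i ^ 2 - 1)
    (hpar : ∀ i ≠ i₀, antipode σ (g i) = -g i) :
    ∃ v : σ → ℝ, ∀ i, eval v (g i) = 0 := by
  classical
  have he : ∀ i, 0 < e i := fun i => by
    by_cases h : i = i₀
    · rw [h, h2]; norm_num
    · exact (hodd i h).pos
  have hsph_even : antipode σ (g i₀) = g i₀ := by simp [hsphere]
  have hpar' : ∀ i, antipode σ (g i) = (-1) ^ e i * g i := fun i => by
    by_cases h : i = i₀
    · rw [h, hsph_even, h2]; ring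
    · rw [hpar i h, (hodd i h).neg_one_pow]; ring
  obtain ⟨χ⟩ := exists_algHom_real_of_odd_finrank
    (A := evenPolynomials σ ⧸ evenIdeal g)
    (by rw [finrank_evenPolynomials_quotient he hg hdeg hpar']; exact odd_card_even_box i₀ h2 hodd)
  let φ : evenPolynomials σ →ₐ[ℝ] ℝ := χ.comp (Ideal.Quotient.mkₐ ℝ (evenIdeal g))
  have hφ : ∀ p ∈ evenIdeal g, φ p = 0 := fun p hp => by
    change χ (Ideal.Quotient.mk _ p) = 0
    rw [Ideal.Quotient.eq_zero_iff_mem.2 hp, map_zero]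
  have hgmem : ∀ i, g i ∈ Ideal.span (Set.range g) := fun i => Ideal.subset_span ⟨i, rfl⟩
  let Y : σ → evenPolynomials σ := fun i =>
    ⟨X i * X i, mul_mem_evenPolynomials_of_odd (antipode_X i) (antipode_X i)⟩
  have hsum : ∑ i, φ (Y i) = 1 := by
    have h := hφ ⟨g i₀, mem_evenPolynomials.2 hsph_even⟩ (hgmem i₀)
    have h' : (⟨g i₀, mem_evenPolynomials.2 hsph_even⟩ : evenPolynomials σ) = ∑ i, Y i - 1 := by
      apply Subtype.ext
      simp [hsphere, Y, pow_two]
    rw [h', map_sub, map_sum, map_one] at h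
    linarith
  obtain ⟨j, hj⟩ : ∃ j, 0 < φ (Y j) := by
    by_contra! h
    have := Finset.sum_nonpos fun i (_ : i ∈ Finset.univ) => h i
    linarith
  obtain ⟨v, hv, hv'⟩ := exists_eval_eq_of_evenPolynomials_character φ j hj
  refine ⟨v, fun i => ?_⟩
  by_cases h : i = i₀
  · rw [h]
    exact (hv ⟨g i₀, mem_evenPolynomials.2 hsph_even⟩).trans (hφ _ (hgmem i₀))
  · refine hv' (g i) (hpar i h) (hφ _ ?_)
    rw [evenIdeal, Ideal.mem_comap]
    exact Ideal.mul_mem_left _ (X j) (hgmem i)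

end RealPoint

section BorsukUlam

open MvPolynomial
open scoped MonomialOrder

theorem degree_degLex_lt_single {σ : Type*} [LinearOrder σ] [WellFoundedGT σ]
    {p : MvPolynomial σ ℝ} {D : ℕ} (hp : p.totalDegree < D) (i : σ) :
    MonomialOrder.degLex.degree p ≺[MonomialOrder.degLex] Finsupp.single i D := by
  rw [MonomialOrder.degLex_lt_iff, Finsupp.DegLex.lt_iff]
  left
  simp only [ofDegLex_toDegLex, Finsupp.degree_single]
  by_cases h : p = 0
  · subst h
    simpa using hp
  · exact (le_totalDegree (MonomialOrder.degLex.degree_mem_support h)).trans_lt hp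

theorem sphereEquation_leading (n : ℕ) :
    MonomialOrder.degLex.Monic (∑ i, X i ^ 2 - 1 : MvPolynomial (Fin (n + 1)) ℝ) ∧
      MonomialOrder.degLex.degree (∑ i, X i ^ 2 - 1 : MvPolynomial (Fin (n + 1)) ℝ) =
        Finsupp.single 0 2 := by
  have hX : MonomialOrder.degLex.degree (X 0 ^ 2 : MvPolynomial (Fin (n + 1)) ℝ) =
      Finsupp.single 0 2 := by
    rw [MonomialOrder.degree_pow, MonomialOrder.degree_X, Finsupp.smul_single]
    rfl
  have hmonic : MonomialOrder.degLex.Monic (X 0 ^ 2 : MvPolynomial (Fin (n + 1)) ℝ) :=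
    MonomialOrder.monic_X.pow
  have hsplit : (∑ i, X i ^ 2 - 1 : MvPolynomial (Fin (n + 1)) ℝ) =
      X 0 ^ 2 + (∑ i : Fin n, X i.succ ^ 2 - 1) := by
    rw [Fin.sum_univ_succ]
    ring
  have hpos : (0 : Fin (n + 1) →₀ ℕ) ≺[MonomialOrder.degLex] Finsupp.single 0 2 := by
    rw [MonomialOrder.degLex_lt_iff, Finsupp.DegLex.lt_iff]
    left
    simp
  have hlt : MonomialOrder.degLex.degree
      (∑ i : Fin n, X i.succ ^ 2 - 1 : MvPolynomial (Fin (n + 1)) ℝ) ≺[MonomialOrder.degLex]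
      MonomialOrder.degLex.degree (X 0 ^ 2 : MvPolynomial (Fin (n + 1)) ℝ) := by
    rw [hX]
    refine lt_of_le_of_lt MonomialOrder.degree_sub_le (max_lt ?_ ?_)
    · refine lt_of_le_of_lt MonomialOrder.degree_sum_le ?_
      rw [Finset.sup_lt_iff (by simpa using hpos)]
      intro i _
      rw [MonomialOrder.degree_pow, MonomialOrder.degree_X, Finsupp.smul_single]
      rw [MonomialOrder.degLex_lt_iff, Finsupp.DegLex.lt_iff]
      right
      refine ⟨by simp, ?_⟩
      rw [Finsupp.Lex.lt_iff]
      exact ⟨0, by simp, by simp⟩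
    · simpa using hpos
  rw [hsplit]
  exact ⟨hmonic.add_of_lt hlt, by rw [MonomialOrder.degree_add_of_lt hlt, hX]⟩

/-- Odd polynomial maps `ℝ^(n+1) → ℝ^n` take arbitrarily small values on the unit sphere. -/
theorem exists_small_value_of_odd_polynomials {n : ℕ}
    (p : Fin n → MvPolynomial (Fin (n + 1)) ℝ) (hp : ∀ i, antipode _ (p i) = -p i)
    {ε : ℝ} (hε : 0 < ε) :
    ∃ v : Fin (n + 1) → ℝ, ∑ i, v i ^ 2 = 1 ∧ ∀ i, |eval v (p i)| ≤ ε := by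
  set D := 2 * (∑ i, (p i).totalDegree) + 1 with hD
  have hDodd : Odd D := ⟨_, rfl⟩
  let e : Fin (n + 1) → ℕ := Fin.cons 2 fun _ => D
  let g : Fin (n + 1) → MvPolynomial (Fin (n + 1)) ℝ :=
    Fin.cons (∑ i, X i ^ 2 - 1) fun i => X i.succ ^ D + C ε⁻¹ * p i
  have hlt : ∀ i : Fin n, MonomialOrder.degLex.degree (C ε⁻¹ * p i) ≺[MonomialOrder.degLex]
      MonomialOrder.degLex.degree (X i.succ ^ D : MvPolynomial (Fin (n + 1)) ℝ) := by
    intro i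
    rw [MonomialOrder.degree_pow, MonomialOrder.degree_X, Finsupp.smul_single]
    simp only [smul_eq_mul, mul_one]
    refine degree_degLex_lt_single ?_ _
    have h1 := totalDegree_mul (C ε⁻¹) (p i)
    have h2 : (p i).totalDegree ≤ ∑ i, (p i).totalDegree :=
      Finset.single_le_sum (f := fun i => (p i).totalDegree) (fun _ _ => Nat.zero_le _)
        (Finset.mem_univ i)
    rw [totalDegree_C] at h1
    omega
  obtain ⟨v, hv⟩ := exists_common_zero (m := MonomialOrder.degLex) (e := e) (g := g)
    (fun i => by
      refine Fin.cases (sphereEquation_leading n).1 (fun i => ?_) i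
      exact MonomialOrder.Monic.add_of_lt (MonomialOrder.monic_X.pow) (hlt i))
    (fun i => by
      refine Fin.cases (sphereEquation_leading n).2 (fun i => ?_) i
      change MonomialOrder.degLex.degree (X i.succ ^ D + C ε⁻¹ * p i) = Finsupp.single i.succ D
      rw [MonomialOrder.degree_add_of_lt (hlt i), MonomialOrder.degree_pow,
        MonomialOrder.degree_X, Finsupp.smul_single, smul_eq_mul, mul_one])
    0 rfl
    (fun i => by
      refine Fin.cases (fun h => absurd rfl h) (fun i _ => ?_) i
      exact hDodd)
    rfl
    (fun i => by
      refine Fin.cases (fun h => absurd rfl h) (fun i _ => ?_) i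
      change antipode _ (X i.succ ^ D + C ε⁻¹ * p i) = -(X i.succ ^ D + C ε⁻¹ * p i)
      rw [map_add, map_mul, map_pow, hp, antipode_X, hDodd.neg_pow,
        show antipode _ (C ε⁻¹) = C ε⁻¹ from (antipode _).commutes _]
      ring)
  have h0 : ∑ i, v i ^ 2 = 1 := by
    have : eval v (∑ i, X i ^ 2 - 1) = 0 := hv 0
    simp only [map_sub, map_sum, map_pow, eval_X, map_one] at this
    linarith
  refine ⟨v, h0, fun i => ?_⟩
  have h1 : eval v (X i.succ ^ D + C ε⁻¹ * p i) = 0 := hv i.succ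
  simp only [map_add, map_mul, map_pow, eval_X, eval_C] at h1
  have h2 : eval v (p i) = -ε * v i.succ ^ D := by
    field_simp at h1
    linarith
  have h3 : |v i.succ| ≤ 1 := by
    rw [← sq_le_one_iff_abs_le_one, ← h0]
    exact Finset.single_le_sum (f := fun i => v i ^ 2) (fun _ _ => sq_nonneg _)
      (Finset.mem_univ _)
  rw [h2, abs_mul, abs_neg, abs_of_pos hε, abs_pow]
  exact mul_le_of_le_one_right hε.le (pow_le_one₀ (abs_nonneg _) h3)

theorem exists_polynomial_near {σ : Type*} {K : Set (σ → ℝ)} (hK : IsCompact K)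
    {f : (σ → ℝ) → ℝ} (hf : ContinuousOn f K) {ε : ℝ} (hε : 0 < ε) :
    ∃ p : MvPolynomial σ ℝ, ∀ v ∈ K, |eval v p - f v| < ε := by
  have := isCompact_iff_compactSpace.1 hK
  let coord : σ → C(K, ℝ) := fun i =>
    ⟨fun v => v.1 i, (continuous_apply i).comp continuous_subtype_val⟩
  have heval : ∀ (p : MvPolynomial σ ℝ) (v : K), aeval coord p v = eval v.1 p := by
    intro p v
    have : (ContinuousMap.evalAlgHom ℝ ℝ v).comp (aeval coord) = aeval v.1 := by
      ext i; simp [coord]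
    exact DFunLike.congr_fun this p
  obtain ⟨⟨_, p, rfl⟩, hp⟩ :=
    ContinuousMap.exists_mem_subalgebra_near_continuous_of_separatesPoints
      (aeval coord : MvPolynomial σ ℝ →ₐ[ℝ] C(K, ℝ)).range (by
        intro x y hxy
        obtain ⟨i, hi⟩ : ∃ i, x.1 i ≠ y.1 i := by
          by_contra! h
          exact hxy (Subtype.ext (funext h))
        exact ⟨coord i, ⟨coord i, ⟨X i, by simp⟩, rfl⟩, hi⟩)
      (fun v : K => f v.1) hf.domRestrict ε hε
  refine ⟨p, fun v hv => ?_⟩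
  have := hp ⟨v, hv⟩
  rw [Real.norm_eq_abs] at this
  convert this using 3
  exact (heval p ⟨v, hv⟩).symm

/-- **Borsuk–Ulam theorem** on the boundary of the cube: an odd continuous map from the unit
sphere of the supremum norm on `ℝ^(n+1)` to `ℝ^n` has a zero. -/
theorem borsuk_ulam {n : ℕ} {F : (Fin (n + 1) → ℝ) → (Fin n → ℝ)}
    (hF : ContinuousOn F (Metric.sphere 0 1)) (hodd : ∀ x ∈ Metric.sphere 0 1, F (-x) = -F x) :
    ∃ x ∈ Metric.sphere (0 : Fin (n + 1) → ℝ) 1, F x = 0 := by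
  by_contra! hne
  obtain ⟨x₀, hx₀, hmin⟩ := (isCompact_sphere (0 : Fin (n + 1) → ℝ) 1).exists_isMinOn
    (NormedSpace.sphere_nonempty.2 zero_le_one) hF.norm
  set δ := ‖F x₀‖ with hδ
  have hδ0 : 0 < δ := norm_pos_iff.2 (hne x₀ hx₀)
  let K : Set (Fin (n + 1) → ℝ) := {v | ∑ i, v i ^ 2 = 1}
  have hKclosed : IsClosed K := isClosed_eq (by fun_prop) continuous_const
  have hK : IsCompact K := by
    refine Metric.isCompact_of_isClosed_isBounded hKclosed ?_
    refine (Metric.isBounded_closedBall (x := (0 : Fin (n + 1) → ℝ)) (r := 1)).subset ?_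
    intro v hv
    rw [mem_closedBall_zero_iff, pi_norm_le_iff_of_nonneg zero_le_one]
    intro i
    rw [Real.norm_eq_abs, ← sq_le_one_iff_abs_le_one]
    have hv' : ∑ i, v i ^ 2 = 1 := hv
    rw [← hv']
    exact Finset.single_le_sum (f := fun i => v i ^ 2) (fun _ _ => sq_nonneg _)
      (Finset.mem_univ _)
  have hK0 : ∀ v ∈ K, v ≠ 0 := by
    rintro v hv rfl
    simp [K] at hv
  have hKneg : ∀ v ∈ K, -v ∈ K := fun v hv => by simpa [K] using hv
  have hnorm : ∀ v ∈ K, ‖v‖⁻¹ • v ∈ Metric.sphere (0 : Fin (n + 1) → ℝ) 1 := fun v hv => by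
    rw [mem_sphere_zero_iff_norm]
    exact norm_smul_inv_norm (𝕜 := ℝ) (hK0 v hv)
  have hcont : ContinuousOn (fun v : Fin (n + 1) → ℝ => F (‖v‖⁻¹ • v)) K := by
    refine hF.comp (ContinuousOn.smul (ContinuousOn.inv₀ continuous_norm.continuousOn
      fun v hv => norm_ne_zero_iff.2 (hK0 v hv)) continuousOn_id) hnorm
  have happrox : ∀ i : Fin n, ∃ p : MvPolynomial (Fin (n + 1)) ℝ, ∀ v ∈ K,
      |eval v p - F (‖v‖⁻¹ • v) i| < δ / 2 := fun i =>
    exists_polynomial_near hK (continuousOn_pi.1 hcont i) (half_pos hδ0)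
  choose p hp using happrox
  obtain ⟨v, hv, hsmall⟩ := exists_small_value_of_odd_polynomials
    (fun i => C (1 / 2) * (p i - antipode _ (p i))) (fun i => by
      rw [map_mul, map_sub, antipode_antipode,
        show antipode _ (C (1 / 2 : ℝ)) = C (1 / 2) from (antipode _).commutes _]
      ring) (half_pos hδ0)
  have hvK : v ∈ K := hv
  have hlt : ‖F (‖v‖⁻¹ • v)‖ < δ := by
    rw [pi_norm_lt_iff hδ0]
    intro i
    have h1 := hp i v hvK
    have h2 := hp i (-v) (hKneg v hvK)
    have h3 := hsmall i
    rw [norm_neg, smul_neg, hodd _ (hnorm v hvK), Pi.neg_apply] at h2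
    simp only [map_mul, map_sub, eval_C, eval_antipode] at h3
    rw [Real.norm_eq_abs]
    rw [abs_lt] at h1 h2 ⊢
    rw [abs_le] at h3
    constructor <;> linarith [h1.1, h1.2, h2.1, h2.2, h3.1, h3.2]
  exact absurd (hmin (hnorm v hvK)) (not_le.2 hlt)

end BorsukUlam

section SparseApproximation

/-- The hat function of the Kuhn triangulation of `ℝ^ι` centred at the lattice point `t`. -/
noncomputable def kuhnHat {ι : Type*} [Fintype ι] (t : ι → ℤ) (y : ι → ℝ) : ℝ :=
  max 0 (1 - ‖(y - fun i => (t i : ℝ))⁺‖ - ‖(y - fun i => (t i : ℝ))⁻‖)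

section KuhnHat

variable {ι : Type*} [Fintype ι] {t t' : ι → ℤ} {y : ι → ℝ}

theorem kuhnHat_nonneg (t : ι → ℤ) (y : ι → ℝ) : 0 ≤ kuhnHat t y :=
  le_max_left _ _

theorem continuous_kuhnHat (t : ι → ℤ) : Continuous (kuhnHat t) := by
  have hp : Continuous fun z : ι → ℝ => z⁺ :=
    continuous_pi fun i => (continuous_apply i).sup continuous_const
  have hn : Continuous fun z : ι → ℝ => z⁻ :=
    continuous_pi fun i => (continuous_apply i).neg.sup continuous_const
  have hs : Continuous fun y : ι → ℝ => y - fun i => (t i : ℝ) := by fun_prop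
  exact continuous_const.max
    ((continuous_const.sub (hp.comp hs).norm).sub (hn.comp hs).norm)

theorem kuhnHat_neg_neg (t : ι → ℤ) (y : ι → ℝ) : kuhnHat (-t) (-y) = kuhnHat t y := by
  have h : (-y - fun i => (((-t) i : ℤ) : ℝ)) = -(y - fun i => (t i : ℝ)) := by
    ext i
    simp
    ring
  rw [kuhnHat, kuhnHat, h, posPart_neg, negPart_neg, sub_right_comm]

theorem sub_add_sub_lt_one_of_kuhnHat_pos (h : 0 < kuhnHat t y) (i j : ι) :
    (y i - t i) + (t j - y j) < 1 := by
  have h' := (lt_max_iff.1 h).resolve_left (lt_irrefl 0)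
  have h1 : y i - t i ≤ ‖(y - fun i => (t i : ℝ))⁺‖ :=
    (le_posPart _).trans ((le_abs_self _).trans (norm_le_pi_norm (y - fun i => (t i : ℝ))⁺ i))
  have h2 : t j - y j ≤ ‖(y - fun i => (t i : ℝ))⁻‖ := by
    have : t j - y j = -(y j - t j) := by ring
    rw [this]
    exact (neg_le_negPart _).trans
      ((le_abs_self _).trans (norm_le_pi_norm (y - fun i => (t i : ℝ))⁻ j))
  linarith

theorem abs_sub_lt_one_of_kuhnHat_pos (h : 0 < kuhnHat t y) (i : ι) : |y i - t i| < 1 := by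
  have h' := (lt_max_iff.1 h).resolve_left (lt_irrefl 0)
  have h1 : y i - t i ≤ ‖(y - fun i => (t i : ℝ))⁺‖ :=
    (le_posPart _).trans ((le_abs_self _).trans (norm_le_pi_norm (y - fun i => (t i : ℝ))⁺ i))
  have h2 : -(y i - t i) ≤ ‖(y - fun i => (t i : ℝ))⁻‖ :=
    (neg_le_negPart _).trans
      ((le_abs_self _).trans (norm_le_pi_norm (y - fun i => (t i : ℝ))⁻ i))
  have h3 := norm_nonneg (y - fun i => (t i : ℝ))⁺
  have h4 := norm_nonneg (y - fun i => (t i : ℝ))⁻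
  rw [abs_lt]
  constructor <;> linarith

theorem kuhnHat_floor_pos (y : ι → ℝ) : 0 < kuhnHat (fun i => ⌊y i⌋) y := by
  have h0 : 0 ≤ y - fun i => (⌊y i⌋ : ℝ) := fun i => Int.fract_nonneg (y i)
  rw [kuhnHat, posPart_of_nonneg h0, negPart_of_nonneg h0, norm_zero, sub_zero]
  refine lt_max_of_lt_right (sub_pos.2 ((pi_norm_lt_iff one_pos).2 fun i => ?_))
  rw [Real.norm_of_nonneg (h0 i)]
  exact Int.fract_lt_one (y i)

theorem le_or_le_of_kuhnHat_pos (h : 0 < kuhnHat t y) (h' : 0 < kuhnHat t' y) :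
    t ≤ t' ∨ t' ≤ t := by
  by_contra! hcon
  obtain ⟨i, hi⟩ := not_forall.1 hcon.1
  obtain ⟨j, hj⟩ := not_forall.1 hcon.2
  have hi' : ((t' i : ℤ) : ℝ) + 1 ≤ t i := by exact_mod_cast not_le.1 hi
  have hj' : ((t j : ℤ) : ℝ) + 1 ≤ t' j := by exact_mod_cast not_le.1 hj
  have := sub_add_sub_lt_one_of_kuhnHat_pos h j i
  have := sub_add_sub_lt_one_of_kuhnHat_pos h' i j
  linarith

theorem card_le_of_kuhnHat_pos {A : Finset (ι → ℤ)} (hA : ∀ t ∈ A, 0 < kuhnHat t y)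
    {i : ι} {k : ℤ} (hk : y i = k) : A.card ≤ Fintype.card ι := by
  classical
  rcases A.eq_empty_or_nonempty with rfl | hne
  · simp
  obtain ⟨t₀, ht₀, hmin⟩ := A.exists_min_image (fun t => ∑ j, t j) hne
  have heq : ∀ t : ι → ℤ, ∀ t' : ι → ℤ, t ≤ t' → ∑ j, t' j ≤ ∑ j, t j → t = t' := by
    intro t t' hle hsum
    have h := (Finset.sum_eq_sum_iff_of_le (s := Finset.univ) fun j _ => hle j).1
      (le_antisymm (Finset.sum_le_sum fun j _ => hle j) hsum)
    exact funext fun j => h j (Finset.mem_univ j)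
  have hcard : A.card ≤ (Finset.Ico (∑ j, t₀ j) (∑ j, t₀ j + Fintype.card ι)).card := by
    refine Finset.card_le_card_of_injOn (fun t => ∑ j, t j) (fun t ht => ?_) ?_
    · refine Finset.mem_coe.2 (Finset.mem_Ico.2 ⟨hmin t ht, ?_⟩)
      have hle : t₀ ≤ t := by
        rcases le_or_le_of_kuhnHat_pos (hA t₀ ht₀) (hA t ht) with h | h
        · exact h
        · exact (heq t t₀ h (hmin t ht)).ge
      have hint : ∀ s ∈ A, s i = k := by
        intro s hs
        have := abs_sub_lt_one_of_kuhnHat_pos (hA s hs) i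
        rw [hk] at this
        have : |k - s i| < 1 := by exact_mod_cast this
        have := Int.abs_lt_one_iff.1 this
        omega
      have hone : ∀ j, t j ≤ t₀ j + 1 := by
        intro j
        have h1 := (abs_lt.1 (abs_sub_lt_one_of_kuhnHat_pos (hA t ht) j)).1
        have h2 := (abs_lt.1 (abs_sub_lt_one_of_kuhnHat_pos (hA t₀ ht₀) j)).2
        have : (t j : ℝ) < t₀ j + 2 := by linarith
        have : t j < t₀ j + 2 := by exact_mod_cast this
        omega
      have : ∑ j, t j < ∑ j, (t₀ j + 1) :=
        Finset.sum_lt_sum (fun j _ => hone j)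
          ⟨i, Finset.mem_univ i, by rw [hint t ht, hint t₀ ht₀]; omega⟩
      simpa [Finset.sum_add_distrib] using this
    · intro t ht t' ht' hsum
      rcases le_or_le_of_kuhnHat_pos (hA t ht) (hA t' ht') with h | h
      · exact heq t t' h hsum.ge
      · exact (heq t' t h hsum.le).symm
  simpa using hcard

end KuhnHat

/-- An odd continuous map from the boundary of a cube can be replaced by an odd map with few
nonzero coordinates, all of whose signs agree with those of the given map. -/
theorem exists_sparse_odd_map {ι V : Type*} [Fintype ι] [Fintype V] [Nonempty V]
    {Φ : (ι → ℝ) → V → ℝ} (hΦ : Continuous Φ) (hodd : ∀ x, Φ (-x) = -Φ x)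
    (hne : ∀ x, x ≠ 0 → Φ x ≠ 0) :
    ∃ c : (ι → ℝ) → V → ℝ, Continuous c ∧ (∀ x, c (-x) = -c x) ∧
      ∀ x ∈ Metric.sphere (0 : ι → ℝ) 1, c x ≠ 0 ∧ (∀ v, c x v ≠ 0 → 0 < c x v * Φ x v) ∧
        {v | c x v ≠ 0}.ncard ≤ Fintype.card ι := by
  classical
  have hmax : ∀ w : V → ℝ, ∃ v, ∀ u, w u ≤ w v := fun w => Finite.exists_max w
  choose top htop using hmax
  obtain ⟨η, hη, hηle⟩ := (isCompact_sphere (0 : ι → ℝ) 1).exists_forall_le'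
    (f := fun x => ‖Φ x‖) hΦ.norm.continuousOn (a := 0) fun x hx =>
      norm_pos_iff.2 (hne x (Metric.ne_of_mem_sphere hx one_ne_zero))
  obtain ⟨δ, hδ, hclose⟩ := Metric.uniformContinuousOn_iff.1
    ((isCompact_closedBall (0 : ι → ℝ) 2).uniformContinuousOn_of_continuous hΦ.continuousOn)
    (η / 2) (half_pos hη)
  obtain ⟨n, hn⟩ := exists_nat_one_div_lt hδ
  set m : ℤ := n + 1 with hm
  have hmR : (m : ℝ) = n + 1 := by simp [hm]
  have hm1 : (1 : ℝ) ≤ m := by rw [hmR]; linarith [n.cast_nonneg (α := ℝ)]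
  have hm0 : (0 : ℝ) < m := by linarith
  let p : (ι → ℤ) → ι → ℝ := fun t i => t i / m
  have hp : ∀ t, p (-t) = -p t := fun t => by ext i; simp [p, neg_div]
  let l : (ι → ℤ) → V → ℝ := fun t => Pi.single (top |Φ (p t)|) (Φ (p t) (top |Φ (p t)|))
  have hl : ∀ t, l (-t) = -l t := fun t => by
    simp only [l, hp, hodd, abs_neg, Pi.neg_apply, Pi.single_neg]
  let B : Finset (ι → ℤ) := Fintype.piFinset fun _ => Finset.Icc (-m) m
  have hB : ∀ t, t ∈ B → -t ∈ B := by
    intro t ht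
    simp only [B, Fintype.mem_piFinset, Finset.mem_Icc, Pi.neg_apply] at ht ⊢
    exact fun i => ⟨by have := ht i; omega, by have := ht i; omega⟩
  let c : (ι → ℝ) → V → ℝ := fun x => ∑ t ∈ B, kuhnHat t ((m : ℝ) • x) • l t
  have hsign : ∀ x ∈ Metric.sphere (0 : ι → ℝ) 1, ∀ t, 0 < kuhnHat t ((m : ℝ) • x) →
      0 < Φ (p t) (top |Φ (p t)|) * Φ x (top |Φ (p t)|) := by
    intro x hx t ht
    have hx1 : ‖x‖ = 1 := by simpa using hx
    have hd : dist (p t) x < 1 / m := by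
      rw [dist_pi_lt_iff (by positivity)]
      intro i
      have := abs_sub_lt_one_of_kuhnHat_pos ht i
      rw [Pi.smul_apply, smul_eq_mul, abs_sub_comm] at this
      rw [Real.dist_eq, lt_div_iff₀ hm0]
      calc |p t i - x i| * m = |(p t i - x i) * m| := by rw [abs_mul, abs_of_pos hm0]
        _ = |t i - m * x i| := by
          congr 1
          simp only [p]
          field_simp
        _ < 1 := this
    have hle : (1 : ℝ) / m ≤ 1 := by rw [div_le_one hm0]; exact hm1
    have hdist : dist (Φ (p t)) (Φ x) < η / 2 := by
      refine hclose _ ?_ _ ?_ (hd.trans ?_)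
      · rw [Metric.mem_closedBall]
        have := dist_triangle (p t) x 0
        rw [dist_zero_right x, hx1] at this
        linarith
      · rw [Metric.mem_closedBall, dist_zero_right, hx1]
        norm_num
      · rw [hmR]
        exact hn
    have hbig : η / 2 < ‖Φ (p t)‖ := by
      have := hηle x hx
      have h2 := norm_sub_norm_le (Φ x) (Φ (p t))
      rw [← dist_eq_norm, dist_comm] at h2
      linarith
    have hnorm : ‖Φ (p t)‖ ≤ |Φ (p t) (top |Φ (p t)|)| :=
      (pi_norm_le_iff_of_nonneg (abs_nonneg _)).2 fun u => htop |Φ (p t)| u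
    have hco : |Φ (p t) (top |Φ (p t)|) - Φ x (top |Φ (p t)|)| < η / 2 :=
      (dist_le_pi_dist (Φ (p t)) (Φ x) _).trans_lt hdist
    rcases abs_lt.1 hco with ⟨h1, h2⟩
    rcases abs_cases (Φ (p t) (top |Φ (p t)|)) with ⟨h3, h4⟩ | ⟨h3, h4⟩
    · exact mul_pos (by linarith) (by linarith)
    · exact mul_pos_of_neg_of_neg (by linarith) (by linarith)
  have hc : ∀ x v, c x v * Φ x v = ∑ t ∈ B, kuhnHat t ((m : ℝ) • x) * (l t v * Φ x v) := by
    intro x v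
    simp only [c, Finset.sum_apply, Pi.smul_apply, smul_eq_mul, Finset.sum_mul, mul_assoc]
  have hterm : ∀ x ∈ Metric.sphere (0 : ι → ℝ) 1, ∀ t v,
      0 ≤ kuhnHat t ((m : ℝ) • x) * (l t v * Φ x v) := by
    intro x hx t v
    rcases (kuhnHat_nonneg t ((m : ℝ) • x)).eq_or_lt with h | h
    · rw [← h, zero_mul]
    refine mul_nonneg h.le ?_
    by_cases hv : v = top |Φ (p t)|
    · subst hv
      simp only [l, Pi.single_eq_same]
      exact (hsign x hx t h).le
    · simp only [l, Pi.single_eq_of_ne hv, zero_mul, le_refl]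
  have hpos : ∀ x ∈ Metric.sphere (0 : ι → ℝ) 1, ∀ t ∈ B, 0 < kuhnHat t ((m : ℝ) • x) →
      0 < c x (top |Φ (p t)|) * Φ x (top |Φ (p t)|) := by
    intro x hx t ht h
    rw [hc]
    refine Finset.sum_pos' (fun s _ => hterm x hx s _) ⟨t, ht, mul_pos h ?_⟩
    simp only [l, Pi.single_eq_same]
    exact hsign x hx t h
  have hex : ∀ x v, c x v ≠ 0 →
      ∃ t ∈ B, 0 < kuhnHat t ((m : ℝ) • x) ∧ top |Φ (p t)| = v := by
    intro x v hv
    simp only [c, Finset.sum_apply, Pi.smul_apply, smul_eq_mul] at hv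
    obtain ⟨t, ht, hne⟩ := Finset.exists_ne_zero_of_sum_ne_zero hv
    refine ⟨t, ht, (kuhnHat_nonneg _ _).lt_of_ne' (left_ne_zero_of_mul hne), ?_⟩
    by_contra hcon
    exact right_ne_zero_of_mul hne (Pi.single_eq_of_ne (Ne.symm hcon) _)
  refine ⟨c, ?_, ?_, fun x hx => ⟨?_, ?_, ?_⟩⟩
  · exact continuous_finsetSum _ fun t _ =>
      ((continuous_kuhnHat t).comp (continuous_const_smul _)).smul continuous_const
  · intro x
    simp only [c]
    rw [← Finset.sum_neg_distrib]
    refine Finset.sum_nbij' (fun t => -t) (fun t => -t) hB hB (fun t _ => neg_neg t)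
      (fun t _ => neg_neg t) fun t _ => ?_
    rw [hl, smul_neg, smul_neg, neg_neg, ← kuhnHat_neg_neg (-t), neg_neg]
  · intro h0
    have hfloor : (fun i => ⌊((m : ℝ) • x) i⌋) ∈ B := by
      simp only [B, Fintype.mem_piFinset, Finset.mem_Icc]
      intro i
      have hxi : |x i| ≤ 1 := by
        have := norm_le_pi_norm x i
        rwa [show ‖x‖ = 1 by simpa using hx] at this
      rw [abs_le] at hxi
      constructor
      · rw [Int.le_floor]
        push_cast
        rw [Pi.smul_apply, smul_eq_mul]
        nlinarith
      · have : (⌊((m : ℝ) • x) i⌋ : ℝ) ≤ m := by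
          refine (Int.floor_le _).trans ?_
          rw [Pi.smul_apply, smul_eq_mul]
          nlinarith
        exact_mod_cast this
    have := hpos x hx _ hfloor (kuhnHat_floor_pos _)
    rw [h0, Pi.zero_apply, zero_mul] at this
    exact lt_irrefl _ this
  · intro v hv
    obtain ⟨t, ht, hpt, rfl⟩ := hex x v hv
    exact hpos x hx t ht hpt
  · have hsub : {v | c x v ≠ 0} ⊆
        ((B.filter fun t => 0 < kuhnHat t ((m : ℝ) • x)).image fun t => top |Φ (p t)| :
          Finset V) := by
      intro v hv
      obtain ⟨t, ht, hpt, htv⟩ := hex x v hv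
      exact Finset.mem_coe.2 (Finset.mem_image.2 ⟨t, Finset.mem_filter.2 ⟨ht, hpt⟩, htv⟩)
    have hcoord : ∃ i, |x i| = 1 := by
      by_contra! hcon
      have hx1 : ‖x‖ = 1 := by simpa using hx
      refine absurd hx1 (ne_of_lt ((pi_norm_lt_iff one_pos).2 fun i => ?_))
      exact lt_of_le_of_ne (hx1 ▸ norm_le_pi_norm x i) (hcon i)
    obtain ⟨i, hi⟩ := hcoord
    have hint : ∃ k : ℤ, ((m : ℝ) • x) i = k := by
      rcases eq_or_eq_neg_of_abs_eq hi with h | h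
      · exact ⟨m, by simp [h]⟩
      · exact ⟨-m, by simp [h]⟩
    obtain ⟨k, hk⟩ := hint
    refine (Set.ncard_le_ncard hsub (Finset.finite_toSet _)).trans ?_
    rw [Set.ncard_coe_finset]
    exact Finset.card_image_le.trans
      (card_le_of_kuhnHat_pos (fun t ht => (Finset.mem_filter.1 ht).2) hk)

end SparseApproximation

section Suspension

variable {V W : Type*} [NormedAddCommGroup W] [NormedSpace ℝ W]

open Classical in
/-- The extension by `0` at the origin of the degree zero homogeneous extension of a map on the
unit sphere. -/
noncomputable def radialExtension (h : Metric.sphere (0 : W) 1 → V → ℝ) (y : W) : V → ℝ :=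
  if hy : y ≠ 0 then h ⟨‖y‖⁻¹ • y, by simp [norm_smul, hy]⟩ else 0

variable {h : Metric.sphere (0 : W) 1 → V → ℝ}

theorem radialExtension_of_ne_zero {y : W} (hy : y ≠ 0) :
    radialExtension h y = h ⟨‖y‖⁻¹ • y, by simp [norm_smul, hy]⟩ :=
  dif_pos hy

theorem radialExtension_zero : radialExtension h 0 = 0 :=
  dif_neg (by simp)

theorem radialExtension_nonneg (h0 : ∀ p v, 0 ≤ h p v) (y : W) (v : V) :
    0 ≤ radialExtension h y v := by
  by_cases hy : y = 0
  · rw [hy, radialExtension_zero, Pi.zero_apply]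
  · rw [radialExtension_of_ne_zero hy]
    exact h0 _ v

theorem continuousAt_radialExtension (hh : Continuous h) {y : W} (hy : y ≠ 0) :
    ContinuousAt (radialExtension h) y := by
  have : ContinuousOn (radialExtension h) {y | y ≠ 0} := by
    rw [continuousOn_iff_continuous_domRestrict]
    have : ({y : W | y ≠ 0}).domRestrict (radialExtension h) = fun y : {y : W | y ≠ 0} =>
        h ⟨‖(y : W)‖⁻¹ • (y : W), by simp [norm_smul, show (y : W) ≠ 0 from y.2]⟩ :=
      funext fun y => radialExtension_of_ne_zero y.2
    rw [this]
    refine hh.comp (Continuous.subtype_mk (Continuous.smul ?_ continuous_subtype_val) _)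
    exact continuous_subtype_val.norm.inv₀ fun y => norm_ne_zero_iff.2 y.2
  exact this.continuousAt (isOpen_ne.mem_nhds hy)

theorem continuous_mul_radialExtension (hh : Continuous h) (h0 : ∀ p v, 0 ≤ h p v)
    (h1 : ∀ p v, h p v ≤ 1) {k : ℝ × W → ℝ} (hk : Continuous k) (hk0 : ∀ x, 0 ≤ k x)
    (hk1 : ∀ x, k x ≤ ‖x.2‖) (v : V) :
    Continuous fun x : ℝ × W => k x * radialExtension h x.2 v := by
  rw [continuous_iff_continuousAt]
  intro x
  by_cases hx : x.2 = 0
  · have hbound : ∀ z : ℝ × W, k z * radialExtension h z.2 v ≤ ‖z.2‖ := by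
      intro z
      by_cases hz : z.2 = 0
      · simp [hz, radialExtension_zero]
      · rw [radialExtension_of_ne_zero hz]
        exact (mul_le_of_le_one_right (hk0 z) (h1 _ v)).trans (hk1 z)
    have hlim : Filter.Tendsto (fun z : ℝ × W => ‖z.2‖) (nhds x) (nhds 0) := by
      have : Continuous fun z : ℝ × W => ‖z.2‖ := by fun_prop
      simpa [hx] using this.tendsto x
    rw [ContinuousAt, hx, radialExtension_zero, Pi.zero_apply, mul_zero]
    exact squeeze_zero (fun z => mul_nonneg (hk0 z) (radialExtension_nonneg h0 _ v)) hbound hlim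
  · refine hk.continuousAt.mul ?_
    have : ContinuousAt (fun z : ℝ × W => radialExtension h z.2) x :=
      ContinuousAt.comp (g := radialExtension h) (continuousAt_radialExtension hh hx)
        continuousAt_snd
    exact (continuous_apply v).continuousAt.comp this

/-- A map from a sphere to a simplex extends to an odd map of the suspension, whose coordinates
have both signs only where they are controlled by the values at two points of the sphere. -/
theorem exists_odd_map_of_sphere [Fintype V] [Nonempty V] (hh : Continuous h)
    (hinj : Function.Injective h) (h0 : ∀ p v, 0 ≤ h p v) (hsum : ∀ p, ∑ v, h p v = 1) :
    ∃ Φ : ℝ × W → V → ℝ, Continuous Φ ∧ (∀ x, Φ (-x) = -Φ x) ∧ (∀ x, x ≠ 0 → Φ x ≠ 0) ∧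
      ∀ x, (∃ v, 0 < Φ x v) → (∃ v, Φ x v < 0) →
        ∃ p q, (∀ v, 0 < Φ x v → h p v ≠ 0) ∧ ∀ v, Φ x v < 0 → h q v ≠ 0 := by
  have h1 : ∀ p v, h p v ≤ 1 := fun p v =>
    hsum p ▸ Finset.single_le_sum (fun u _ => h0 p u) (Finset.mem_univ v)
  let k : ℝ × W → ℝ := fun x => max 0 (‖x.2‖ - max 0 (-x.1))
  have hk0 : ∀ x, 0 ≤ k x := fun x => le_max_left _ _
  have hk1 : ∀ x, k x ≤ ‖x.2‖ := fun x =>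
    max_le (norm_nonneg _) (sub_le_self _ (le_max_left _ _))
  let A : ℝ × W → V → ℝ := fun x v => k x * radialExtension h x.2 v + max 0 (x.1 - ‖x.2‖)
  have hA : Continuous A := by
    refine continuous_pi fun v => ?_
    exact (continuous_mul_radialExtension hh h0 h1 (by fun_prop) hk0 hk1 v).add (by fun_prop)
  have hA0 : ∀ x v, 0 ≤ A x v := fun x v =>
    add_nonneg (mul_nonneg (hk0 x) (radialExtension_nonneg h0 _ v)) (le_max_left _ _)
  have hAneg : ∀ x : ℝ × W, ‖x.2‖ ≤ x.1 → A (-x) = 0 := by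
    intro x hx
    have hn := norm_nonneg x.2
    ext v
    simp only [A, k, Prod.snd_neg, Prod.fst_neg, norm_neg, neg_neg, Pi.zero_apply]
    rw [max_eq_right (hn.trans hx), max_eq_left (by linarith), max_eq_left (by linarith)]
    ring
  have hpole : ∀ x v, A x v - A (-x) v < 0 → x.1 < ‖x.2‖ := by
    intro x v hv
    by_contra! hx
    rw [hAneg x hx, Pi.zero_apply, sub_zero] at hv
    exact hv.not_ge (hA0 x v)
  have hAsupp : ∀ x : ℝ × W, x.1 < ‖x.2‖ → ∀ v, 0 < A x v → radialExtension h x.2 v ≠ 0 := by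
    intro x hx v hv hv0
    simp only [A, hv0, mul_zero, zero_add] at hv
    rw [max_eq_left (by linarith)] at hv
    exact lt_irrefl _ hv
  have hAsum : ∀ x, ∑ v, A x v = k x + Fintype.card V * max 0 (x.1 - ‖x.2‖) := by
    intro x
    simp only [A, Finset.sum_add_distrib, ← Finset.mul_sum, Finset.sum_const, Finset.card_univ,
      nsmul_eq_mul]
    by_cases hx : x.2 = 0
    · have : k x = 0 := le_antisymm (by simpa [hx] using hk1 x) (hk0 x)
      rw [this, zero_mul]
    · rw [radialExtension_of_ne_zero hx, hsum, mul_one]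
  have hsumpos : ∀ x : ℝ × W, 0 < x.1 → ∑ v, A (-x) v < ∑ v, A x v := by
    intro x hx
    rw [hAsum, hAsum]
    have hcard : (0 : ℝ) < Fintype.card V := by exact_mod_cast Fintype.card_pos
    have hn := norm_nonneg x.2
    simp only [k, Prod.snd_neg, Prod.fst_neg, norm_neg, neg_neg]
    rw [max_eq_right hx.le, max_eq_left (a := (0 : ℝ)) (b := -x.1) (by linarith),
      max_eq_left (a := (0 : ℝ)) (b := -x.1 - ‖x.2‖) (by linarith), mul_zero, add_zero, sub_zero,
      max_eq_right hn]
    rcases le_or_gt x.1 ‖x.2‖ with hle | hlt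
    · rw [max_eq_right (by linarith), max_eq_left (by linarith)]
      linarith
    · rw [max_eq_left (by linarith), max_eq_right (by linarith)]
      have := mul_pos hcard (sub_pos.2 hlt)
      linarith
  refine ⟨fun x => A x - A (-x), hA.sub (hA.comp continuous_neg), fun x => by
    simp only [neg_neg, neg_sub], fun x hx h0' => ?_, fun x => ?_⟩
  · have heq : A x = A (-x) := sub_eq_zero.1 h0'
    rcases lt_trichotomy x.1 0 with hlt | hz | hgt
    · have := hsumpos (-x) (by simpa using hlt)
      rw [neg_neg, heq] at this
      exact lt_irrefl _ this
    · have hy : x.2 ≠ 0 := fun hy => hx (Prod.ext hz hy)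
      have hn := norm_pos_iff.2 hy
      have : radialExtension h x.2 = radialExtension h (-x.2) := by
        ext v
        have := congr_fun heq v
        simp only [A, k, hz, Prod.snd_neg, Prod.fst_neg, norm_neg, neg_zero, max_self, sub_zero,
          zero_sub] at this
        rw [max_eq_right hn.le, max_eq_left (by linarith), add_zero, add_zero] at this
        exact mul_left_cancel₀ hn.ne' this
      rw [radialExtension_of_ne_zero hy, radialExtension_of_ne_zero (neg_ne_zero.2 hy)] at this
      have := congr_arg Subtype.val (hinj this)
      simp only [norm_neg, smul_neg] at this
      rw [eq_neg_iff_add_eq_zero, ← two_smul ℝ, smul_smul, smul_eq_zero] at this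
      exact this.elim (mul_ne_zero two_ne_zero (inv_ne_zero hn.ne')) hy
    · have := hsumpos x hgt
      rw [heq] at this
      exact lt_irrefl _ this
  · rintro ⟨v, hv⟩ ⟨u, hu⟩
    simp only [Pi.sub_apply] at hu hv ⊢
    have hlt := hpole x u hu
    have hlt' := hpole (-x) v (by rw [neg_neg]; linarith)
    have hy : x.2 ≠ 0 := by
      intro hy
      rw [hy, norm_zero] at hlt
      rw [Prod.snd_neg, hy, neg_zero, norm_zero, Prod.fst_neg] at hlt'
      linarith
    refine ⟨⟨‖x.2‖⁻¹ • x.2, by simp [norm_smul, hy]⟩, ⟨‖-x.2‖⁻¹ • -x.2, by simp [norm_smul, hy]⟩,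
      fun w hw => ?_, fun w hw => ?_⟩
    · rw [← radialExtension_of_ne_zero (h := h) hy]
      exact hAsupp x hlt w (by linarith [hA0 (-x) w])
    · rw [← radialExtension_of_ne_zero (h := h) (neg_ne_zero.2 hy)]
      exact hAsupp (-x) hlt' w (by linarith [hA0 x w])

end Suspension

section Realization

theorem mem_ptSupport {V : Type} [Fintype V] {K : Finset (Finset V)} {x : GeomRep K} {v : V} :
    v ∈ ptSupport x ↔ x.1 v ≠ 0 := by
  simp [ptSupport]

theorem ptSupport_mem {V : Type} [Fintype V] {K : Finset (Finset V)} (x : GeomRep K) :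
    ptSupport x ∈ K :=
  x.2.2.2.2

theorem exists_geomRep_eq {V : Type} [DecidableEq V] [Fintype V] {K : Finset (Finset V)}
    (hK : IsComplex K) {σ : Finset V} (hσ : σ ∈ K) {X : V → ℝ} (h0 : ∀ v, 0 ≤ X v)
    (hsum : ∑ v, X v = 1) (hX : ∀ v, X v ≠ 0 → v ∈ σ) : ∃ x : GeomRep K, x.1 = X := by
  refine ⟨⟨X, h0, fun v => ?_, hsum, hK.2 σ hσ _ (fun v hv => hX v (by simpa using hv)) ?_⟩, rfl⟩
  · rw [← hsum]
    exact Finset.single_le_sum (fun u _ => h0 u) (Finset.mem_univ v)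
  · obtain ⟨v, -, hv⟩ := Finset.exists_ne_zero_of_sum_ne_zero (hsum.trans_ne one_ne_zero)
    exact ⟨v, by simpa using hv⟩

end Realization

/-- Proposition 3.1 (Borsuk–Ulam type statement, intersection-nonemptiness form):
if `S` is a triangulated `d`-sphere and `f : ‖S‖ → ℝ^d` is a continuous map in general
position (images of realizations of vertex-disjoint faces of total dimension `< d` are
disjoint), then there are two disjoint faces `σ, τ` with `dim σ + dim τ = d` whose images
`f(‖σ‖)` and `f(‖τ‖)` intersect.  Note `dim σ + dim τ = d ↔ |σ| + |τ| = d + 2`. -/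
theorem borsukUlam_triangulated_sphere
    {V : Type} [DecidableEq V] [Fintype V] (d : ℕ) (hd : 1 ≤ d)
    (S : Finset (Finset V)) (hS : IsComplex S)
    (hSsphere : Nonempty
      (GeomRep S ≃ₜ Metric.sphere (0 : EuclideanSpace ℝ (Fin (d + 1))) 1))
    (f : GeomRep S → EuclideanSpace ℝ (Fin d)) (hf : Continuous f)
    (hgen : ∀ σ ∈ S, ∀ τ ∈ S, Disjoint σ τ → σ.card + τ.card < d + 2 →
      ∀ x y : GeomRep S, ptSupport x ⊆ σ → ptSupport y ⊆ τ → f x ≠ f y) :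
    ∃ σ ∈ S, ∃ τ ∈ S, Disjoint σ τ ∧ σ.card + τ.card = d + 2 ∧
      ∃ x y : GeomRep S, ptSupport x ⊆ σ ∧ ptSupport y ⊆ τ ∧ f x = f y := by
  obtain ⟨e⟩ := hSsphere
  have hval : Continuous fun x : GeomRep S => x.1 := continuous_subtype_val
  let h : Metric.sphere (0 : EuclideanSpace ℝ (Fin (d + 1))) 1 → V → ℝ := fun p => (e.symm p).1
  have hV : Nonempty V := by
    by_contra hV
    rw [not_nonempty_iff] at hV
    have x : GeomRep S := e.symm ⟨EuclideanSpace.single 0 1, by simp⟩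
    simpa using x.2.2.2.1
  obtain ⟨Φ, hΦ, hΦodd, hΦne, hΦsupp⟩ := exists_odd_map_of_sphere (h := h)
    (hval.comp e.symm.continuous) (fun p q hpq => e.symm.injective (Subtype.ext hpq))
    (fun p v => (e.symm p).2.1 v) (fun p => (e.symm p).2.2.2.1)
  let L : (Fin (d + 1 + 1) → ℝ) → ℝ × EuclideanSpace ℝ (Fin (d + 1)) := fun x =>
    (x 0, WithLp.toLp 2 (Fin.tail x))
  have hL : Continuous L := by
    refine (continuous_apply 0).prodMk ((PiLp.continuous_toLp 2 _).comp ?_)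
    exact continuous_pi fun i => continuous_apply i.succ
  have hLneg : ∀ x, L (-x) = -L x := fun x => rfl
  have hLne : ∀ x, x ≠ 0 → L x ≠ 0 := by
    intro x hx h0
    refine hx (funext fun i => ?_)
    have h1 : x 0 = 0 := congr_arg Prod.fst h0
    have h2 : ∀ i : Fin (d + 1), x i.succ = 0 := fun i =>
      congr_fun (congr_arg (fun z => WithLp.ofLp (Prod.snd z)) h0) i
    exact Fin.cases h1 h2 i
  obtain ⟨c, hc, hcodd, hcK⟩ := exists_sparse_odd_map (Φ := fun x => Φ (L x)) (hΦ.comp hL)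
    (fun x => by rw [hLneg, hΦodd]) (fun x hx => hΦne _ (hLne x hx))
  have : CompactSpace (GeomRep S) := e.symm.compactSpace
  obtain ⟨g, hg⟩ := ContinuousMap.exists_extension' (X := V → ℝ) (e := fun x : GeomRep S => x.1)
    (hval.isClosedEmbedding Subtype.val_injective)
    (⟨fun x => WithLp.ofLp (f x), (PiLp.continuous_ofLp 2 _).comp hf⟩ : C(GeomRep S, Fin d → ℝ))
  have hgf : ∀ x : GeomRep S, g x.1 = WithLp.ofLp (f x) := fun x => congr_fun hg x
  let a : (V → ℝ) → ℝ := fun u => (∑ v, |u v|) / 2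
  have ha : Continuous a := by fun_prop
  have ha0 : ∀ u, u ≠ 0 → 0 < a u := by
    intro u hu
    obtain ⟨v, hv⟩ := Function.ne_iff.1 hu
    exact half_pos (Finset.sum_pos' (fun _ _ => abs_nonneg _)
      ⟨v, Finset.mem_univ v, abs_pos.2 hv⟩)
  let P : (V → ℝ) → V → ℝ := fun u => (a u)⁻¹ • fun v => max (u v) 0
  have hP : ContinuousOn P {u | u ≠ 0} := by
    refine ContinuousOn.smul (ha.continuousOn.inv₀ fun u hu => (ha0 u hu).ne')
      (Continuous.continuousOn ?_)
    fun_prop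
  let F : (Fin (d + 1 + 1) → ℝ) → Fin (d + 1) → ℝ := fun x =>
    Fin.cons (∑ v, c x v) (g (P (c x)) - g (P (-c x)))
  have hF : ContinuousOn F (Metric.sphere 0 1) := by
    have h1 : ContinuousOn (fun x => g (P (c x))) (Metric.sphere 0 1) :=
      g.continuous.comp_continuousOn (hP.comp hc.continuousOn fun x hx => (hcK x hx).1)
    have h2 : ContinuousOn (fun x => g (P (-c x))) (Metric.sphere 0 1) :=
      g.continuous.comp_continuousOn
        (hP.comp hc.neg.continuousOn fun x hx => neg_ne_zero.2 (hcK x hx).1)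
    refine continuousOn_pi.2 fun i => ?_
    refine Fin.cases ?_ (fun i => ?_) i
    · simp only [F, Fin.cons_zero]
      exact Continuous.continuousOn (by fun_prop)
    · simp only [F, Fin.cons_succ]
      exact (continuous_apply i).comp_continuousOn (h1.sub h2)
  obtain ⟨x, hx, hFx⟩ := borsuk_ulam hF fun x _ => by
    ext i
    refine Fin.cases ?_ (fun i => ?_) i
    · simp [F, hcodd]
    · simp [F, hcodd]
  obtain ⟨hcne, hcsign, hccard⟩ := hcK x hx
  have hsum : ∑ v, c x v = 0 := congr_fun hFx 0
  have hgg : g (P (c x)) = g (P (-c x)) :=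
    sub_eq_zero.1 (funext fun i => congr_fun hFx i.succ)
  have hPsum : ∀ u : V → ℝ, u ≠ 0 → ∑ v, u v = 0 → ∑ v, P u v = 1 := by
    intro u hu hs
    have : ∑ v, max (u v) 0 = a u := by
      have h1 : ∀ v, max (u v) 0 = (u v + |u v|) / 2 := by
        intro v
        rcases abs_cases (u v) with ⟨h1, h2⟩ | ⟨h1, h2⟩
        · rw [h1, max_eq_left h2]; ring
        · rw [h1, max_eq_right h2.le]; ring
      simp only [h1, ← Finset.sum_div, Finset.sum_add_distrib, hs, zero_add, a]
    simp only [P, Pi.smul_apply, smul_eq_mul, ← Finset.mul_sum]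
    rw [this, inv_mul_cancel₀ (ha0 u hu).ne']
  have hP0 : ∀ u v, 0 ≤ P u v := fun u v =>
    mul_nonneg (inv_nonneg.2 (div_nonneg (Finset.sum_nonneg fun _ _ => abs_nonneg _) two_pos.le))
      (le_max_right _ _)
  have hPpos : ∀ u v, P u v ≠ 0 → 0 < u v := by
    intro u v hv
    by_contra! hle
    exact hv (by simp [P, hle])
  have hneg_ne : -c x ≠ 0 := neg_ne_zero.2 hcne
  have hneg_sum : ∑ v, (-c x) v = 0 := by simp [hsum]
  have hΦpos : ∀ v, 0 < c x v → 0 < Φ (L x) v := fun v hv =>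
    (mul_pos_iff_of_pos_left hv).1 (hcsign v hv.ne')
  have hΦneg : ∀ v, 0 < (-c x) v → Φ (L x) v < 0 := fun v hv => by
    rw [Pi.neg_apply, neg_pos] at hv
    have := hcsign v hv.ne
    by_contra! hle
    exact this.not_ge (mul_nonpos_of_nonpos_of_nonneg hv.le hle)
  have hex : ∀ u : V → ℝ, u ≠ 0 → ∑ v, u v = 0 → ∃ v, 0 < u v := fun u hu hs => by
    obtain ⟨v, -, hv⟩ := Finset.exists_ne_zero_of_sum_ne_zero
      ((hPsum u hu hs).trans_ne one_ne_zero)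
    exact ⟨v, hPpos u v hv⟩
  obtain ⟨p, q, hp, hq⟩ := hΦsupp (L x) ((hex _ hcne hsum).imp hΦpos)
    ((hex _ hneg_ne hneg_sum).imp hΦneg)
  obtain ⟨X, hX⟩ := exists_geomRep_eq hS (ptSupport_mem (e.symm p)) (hP0 _) (hPsum _ hcne hsum)
    fun v hv => mem_ptSupport.2 (hp v (hΦpos v (hPpos _ v hv)))
  obtain ⟨Y, hY⟩ := exists_geomRep_eq hS (ptSupport_mem (e.symm q)) (hP0 _)
    (hPsum _ hneg_ne hneg_sum) fun v hv => mem_ptSupport.2 (hq v (hΦneg v (hPpos _ v hv)))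
  have hXpos : ∀ v ∈ ptSupport X, 0 < c x v := fun v hv =>
    hPpos _ v (hX ▸ mem_ptSupport.1 hv)
  have hYpos : ∀ v ∈ ptSupport Y, c x v < 0 := fun v hv =>
    neg_pos.1 (hPpos (-c x) v (hY ▸ mem_ptSupport.1 hv))
  have hXY : f X = f Y := by
    refine WithLp.ofLp_injective 2 ?_
    rw [← hgf, ← hgf, hX, hY, hgg]
  have hdisj : Disjoint (ptSupport X) (ptSupport Y) :=
    Finset.disjoint_left.2 fun v hv hv' => (hXpos v hv).not_gt (hYpos v hv')
  have hcard : (ptSupport X).card + (ptSupport Y).card ≤ d + 2 := by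
    rw [← Finset.card_union_of_disjoint hdisj, ← Set.ncard_coe_finset]
    refine (Set.ncard_le_ncard (fun v hv => ?_) (Set.toFinite _)).trans
      (hccard.trans (by rw [Fintype.card_fin]))
    rcases Finset.mem_union.1 (Finset.mem_coe.1 hv) with h | h
    · exact (hXpos v h).ne'
    · exact (hYpos v h).ne
  refine ⟨_, ptSupport_mem X, _, ptSupport_mem Y, hdisj, ?_, X, Y, subset_rfl, subset_rfl, hXY⟩
  by_contra hne
  exact hgen _ (ptSupport_mem X) _ (ptSupport_mem Y) hdisj (lt_of_le_of_ne hcard hne) X Y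
    subset_rfl subset_rfl hXY
end

section
/- Let S be a finite abstract simplicial complex with ‖S‖ homeomorphic to the 2-sphere S², and let M = {u, v} be a missing edge of S, i.e., u and v are vertices of S but {u, v} is not a face of S. Then the complex K := S_{≤1} ∪ {M} does not embed in S²: there is no continuous injective map ‖K‖ → S². -/
/-- Every continuous function `X → ℂ \ {0}` has a continuous logarithm. -/
def HasContinuousLogs {Y : Type*} [TopologicalSpace Y] (X : Set Y) : Prop :=
  ∀ g : Y → ℂ, ContinuousOn g X → (∀ x ∈ X, g x ≠ 0) →
    ∃ l : Y → ℂ, ContinuousOn l X ∧ ∀ x ∈ X, Complex.exp (l x) = g x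

namespace HasContinuousLogs

variable {Y Z : Type*} [TopologicalSpace Y] [TopologicalSpace Z]

theorem of_retract {X : Set Y} {X' : Set Z} (hX : HasContinuousLogs X) {φ : Y → Z} {ψ : Z → Y}
    (hφ : ContinuousOn φ X) (hφX : Set.MapsTo φ X X') (hψ : ContinuousOn ψ X')
    (hψX : Set.MapsTo ψ X' X) (h : ∀ z ∈ X', φ (ψ z) = z) : HasContinuousLogs X' := by
  intro g hg hg0
  obtain ⟨l, hl, hle⟩ := hX (g ∘ φ) (hg.comp hφ hφX) fun x hx => hg0 _ (hφX hx)
  refine ⟨l ∘ ψ, hl.comp hψ hψX, fun z hz => ?_⟩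
  simp [hle _ (hψX hz), h z hz]

theorem of_finite [T1Space Y] {X : Set Y} (hX : X.Finite) : HasContinuousLogs X :=
  fun g _ hg0 => ⟨fun x => Complex.log (g x), hX.continuousOn _,
    fun x hx => Complex.exp_log (hg0 x hx)⟩

theorem of_starConvex {E : Type*} [AddCommGroup E] [Module ℝ E] [TopologicalSpace E]
    [ContinuousAdd E] [ContinuousSMul ℝ E] {X : Set E} {x₀ : E} (hX : StarConvex ℝ x₀ X) :
    HasContinuousLogs X := by
  intro g hg hg0
  have hmem (s : unitInterval) (x : X) : (1 - (s : ℝ)) • x₀ + (s : ℝ) • (x : E) ∈ X :=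
    hX x.2 (by linarith [s.2.2]) s.2.1 (by ring)
  let H : C(unitInterval × X, {z : ℂ // z ≠ 0}) :=
    { toFun := fun p => ⟨g ((1 - (p.1 : ℝ)) • x₀ + (p.1 : ℝ) • (p.2 : E)), hg0 _ (hmem _ _)⟩
      continuous_toFun := by
        refine Continuous.subtype_mk ?_ _
        exact hg.comp_continuous (by fun_prop) fun p => hmem _ _ }
  have h0 (x : X) : H (0, x) = (⟨_, (Complex.log (g x₀)).exp_ne_zero⟩ : {z : ℂ // z ≠ 0}) := by
    have : g x₀ ≠ 0 := hg0 _ (by simpa using hmem 0 x)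
    apply Subtype.ext
    simp [H, Complex.exp_log this]
  let f : C(X, ℂ) := ContinuousMap.const _ (Complex.log (g x₀))
  let G := Complex.isCoveringMap_exp.liftHomotopy H f h0
  classical
  refine ⟨fun x => if h : x ∈ X then G (1, ⟨x, h⟩) else 0, ?_, fun x hx => ?_⟩
  · rw [continuousOn_iff_continuous_domRestrict]
    have : X.domRestrict (fun x => if h : x ∈ X then G (1, ⟨x, h⟩) else 0) = fun x => G (1, x) := by
      ext x; simp
    rw [this]
    fun_prop
  · have := congrArg Subtype.val
      (congrFun (Complex.isCoveringMap_exp.liftHomotopy_lifts H f h0) (1, ⟨x, hx⟩))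
    simpa [hx, G, H] using this

end HasContinuousLogs

/-- Two continuous logarithms of the same function on a preconnected set differ by a constant. -/
theorem continuousLog_sub_eq {Y : Type*} [TopologicalSpace Y] {X : Set Y} (hX : IsPreconnected X)
    {l l' : Y → ℂ} (hl : ContinuousOn l X) (hl' : ContinuousOn l' X)
    (h : ∀ x ∈ X, Complex.exp (l x) = Complex.exp (l' x)) {x y : Y} (hx : x ∈ X) (hy : y ∈ X) :
    l x - l y = l' x - l' y := by
  have := Subtype.preconnectedSpace hX
  have key := Complex.isCoveringMap_exp.eq_of_comp_eq
    (g₁ := X.domRestrict l) (g₂ := fun z : X => l' z + (l y - l' y))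
    hl.domRestrict (hl'.domRestrict.add continuous_const)
    (by
      funext z
      apply Subtype.ext
      simp [Complex.exp_add, Complex.exp_sub, h z z.2, h y hy, Complex.exp_ne_zero])
    ⟨y, hy⟩ (by simp)
  have := congrFun key ⟨x, hx⟩
  simp only [Set.domRestrict_apply] at this
  rw [this]
  ring

open Classical in
/-- The total change of a continuous logarithm of `g` along the unit interval. -/
noncomputable def logIncrement (g : ℝ → ℂ) : ℂ :=
  if h : ∃ l : ℝ → ℂ, ContinuousOn l (Set.Icc 0 1) ∧
      ∀ t ∈ Set.Icc (0 : ℝ) 1, Complex.exp (l t) = g t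
  then h.choose 1 - h.choose 0 else 0

theorem logIncrement_eq {g l : ℝ → ℂ} (hl : ContinuousOn l (Set.Icc 0 1))
    (h : ∀ t ∈ Set.Icc (0 : ℝ) 1, Complex.exp (l t) = g t) :
    logIncrement g = l 1 - l 0 := by
  have hex : ∃ l : ℝ → ℂ, ContinuousOn l (Set.Icc 0 1) ∧
    ∀ t ∈ Set.Icc (0 : ℝ) 1, Complex.exp (l t) = g t := ⟨l, hl, h⟩
  rw [logIncrement, dif_pos hex]
  exact continuousLog_sub_eq isPreconnected_Icc hex.choose_spec.1 hl
    (fun t ht => (hex.choose_spec.2 t ht).trans (h t ht).symm) (by simp) (by simp)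

theorem exists_log_Icc {g : ℝ → ℂ} (hg : ContinuousOn g (Set.Icc 0 1))
    (h0 : ∀ t ∈ Set.Icc (0 : ℝ) 1, g t ≠ 0) :
    ∃ l : ℝ → ℂ, ContinuousOn l (Set.Icc 0 1) ∧ ∀ t ∈ Set.Icc (0 : ℝ) 1, Complex.exp (l t) = g t :=
  HasContinuousLogs.of_starConvex ((convex_Icc (0 : ℝ) 1).starConvex (x := 0) (by simp)) g hg h0

theorem exp_logIncrement {g : ℝ → ℂ} (hg : ContinuousOn g (Set.Icc 0 1))
    (h0 : ∀ t ∈ Set.Icc (0 : ℝ) 1, g t ≠ 0) :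
    Complex.exp (logIncrement g) = g 1 / g 0 := by
  obtain ⟨l, hl, h⟩ := exists_log_Icc hg h0
  rw [logIncrement_eq hl h, Complex.exp_sub, h 1 (by simp), h 0 (by simp)]

theorem logIncrement_reverse {g : ℝ → ℂ} (hg : ContinuousOn g (Set.Icc 0 1))
    (h0 : ∀ t ∈ Set.Icc (0 : ℝ) 1, g t ≠ 0) :
    logIncrement (fun t => g (1 - t)) = -logIncrement g := by
  obtain ⟨l, hl, h⟩ := exists_log_Icc hg h0
  have hm : Set.MapsTo (fun t : ℝ => 1 - t) (Set.Icc 0 1) (Set.Icc 0 1) := fun t ht =>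
    ⟨by linarith [ht.2], by linarith [ht.1]⟩
  rw [logIncrement_eq hl h,
    logIncrement_eq (l := fun t => l (1 - t)) (hl.comp (by fun_prop) hm) fun t ht => h _ (hm ht)]
  simp

/-- The increments of the logarithm of `γ s - δ t` around the boundary of the unit square
cancel. -/
theorem logIncrement_square {γ δ : ℝ → ℂ} (hγ : ContinuousOn γ (Set.Icc 0 1))
    (hδ : ContinuousOn δ (Set.Icc 0 1))
    (h : ∀ s ∈ Set.Icc (0 : ℝ) 1, ∀ t ∈ Set.Icc (0 : ℝ) 1, γ s ≠ δ t) :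
    logIncrement (fun s => γ s - δ 0) + logIncrement (fun t => δ t - γ 1) =
      logIncrement (fun s => γ s - δ 1) + logIncrement (fun t => δ t - γ 0) := by
  have hsq : StarConvex ℝ (0 : ℝ × ℝ) (Set.Icc (0 : ℝ) 1 ×ˢ Set.Icc (0 : ℝ) 1) :=
    ((convex_Icc (0 : ℝ) 1).prod (convex_Icc (0 : ℝ) 1)).starConvex (by simp [Prod.le_def])
  obtain ⟨l, hl, hle⟩ := HasContinuousLogs.of_starConvex hsq (fun p => γ p.1 - δ p.2)
    ((hγ.comp continuousOn_fst fun p hp => hp.1).sub (hδ.comp continuousOn_snd fun p hp => hp.2))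
    fun p hp => sub_ne_zero.2 (h _ hp.1 _ hp.2)
  have h1 (t : ℝ) (ht : t ∈ Set.Icc (0 : ℝ) 1) :
      logIncrement (fun s => γ s - δ t) = l (1, t) - l (0, t) :=
    logIncrement_eq (l := fun s => l (s, t))
      (hl.comp (by fun_prop) fun s hs => ⟨hs, ht⟩) fun s hs => hle (s, t) ⟨hs, ht⟩
  have h2 (s : ℝ) (hs : s ∈ Set.Icc (0 : ℝ) 1) :
      logIncrement (fun t => δ t - γ s) = l (s, 1) - l (s, 0) := by
    rw [logIncrement_eq (l := fun t => l (s, t) + Real.pi * Complex.I)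
      ((hl.comp (by fun_prop) fun t ht => ⟨hs, ht⟩).add continuousOn_const) fun t ht => ?_]
    · ring
    · rw [Complex.exp_add, Complex.exp_pi_mul_I, hle (s, t) ⟨hs, ht⟩]
      ring
  rw [h1 0 (by simp), h1 1 (by simp), h2 0 (by simp), h2 1 (by simp)]
  ring

/-- A bounded relatively open piece `Z \ X` of the plane is not cut off by a set `X` with
continuous logarithms. -/
theorem HasContinuousLogs.not_isOpen_diff {X Z : Set ℂ} (hlog : HasContinuousLogs X)
    (hZ : IsCompact Z) (hX : IsClosed X) (hU : IsOpen (Z \ X)) {p : ℂ}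
    (hp : p ∈ Z \ X) : False := by
  classical
  obtain ⟨l, hl, hle⟩ := hlog (fun z => z - p) (by fun_prop)
    fun x hx => sub_ne_zero.2 fun h => hp.2 (h ▸ hx)
  obtain ⟨L, hL⟩ := ContinuousMap.exists_restrict_eq hX
    (⟨X.domRestrict l, hl.domRestrict⟩ : C(X, ℂ))
  have hLl (x : ℂ) (hx : x ∈ X) : L x = l x := congrArg (fun f : C(X, ℂ) => f ⟨x, hx⟩) hL
  let F : ℂ → ℂ := Z.piecewise (fun z => Complex.exp (L z)) fun z => z - p
  have hfr : frontier Z ⊆ X := fun z hz => by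
    by_contra hzX
    have hzZ : z ∈ Z := hZ.isClosed.frontier_subset hz
    exact hz.2 (interior_maximal Set.sdiff_subset hU (show z ∈ Z \ X from ⟨hzZ, hzX⟩))
  have hF : Continuous F := by
    refine Continuous.piecewise (fun z hz => ?_) (by fun_prop) (by fun_prop)
    rw [hLl z (hfr hz), hle z (hfr hz)]
  have hF0 (z : ℂ) : F z ≠ 0 := by
    by_cases hz : z ∈ Z
    · simp [F, hz]
    · simpa [F, hz, sub_eq_zero] using fun h : z = p => hz (h ▸ hp.1)
  obtain ⟨M, hM, hMe⟩ := HasContinuousLogs.of_starConvex (starConvex_univ (𝕜 := ℝ) (0 : ℂ)) F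
    hF.continuousOn fun z _ => hF0 z
  obtain ⟨R, hR⟩ := hZ.isBounded.subset_ball p
  have hRpos : 0 < R := by simpa using hR hp.1
  let c : ℝ → ℂ := fun t => p + R * Complex.exp (2 * Real.pi * t * Complex.I)
  have hc : ContinuousOn c (Set.Icc 0 1) := by fun_prop
  have hcZ (t : ℝ) : c t ∉ Z := fun h => by
    have := hR h
    rw [Metric.mem_ball, dist_eq_norm] at this
    simp only [c, add_sub_cancel_left, norm_mul, Complex.norm_real, Real.norm_eq_abs,
      abs_of_pos hRpos] at this
    rw [show (2 * Real.pi * t * Complex.I : ℂ) = ((2 * Real.pi * t : ℝ) : ℂ) * Complex.I by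
      push_cast; ring, Complex.norm_exp_ofReal_mul_I] at this
    linarith
  have hFc (t : ℝ) : F (c t) = R * Complex.exp (2 * Real.pi * t * Complex.I) := by
    simp [F, hcZ t, c]
  have h1 := logIncrement_eq (g := F ∘ c) (l := M ∘ c)
    (hM.comp hc fun _ _ => Set.mem_univ _) fun t _ => hMe _ trivial
  have h2 := logIncrement_eq (g := F ∘ c)
    (l := fun t => Complex.log R + 2 * Real.pi * t * Complex.I) (by fun_prop) fun t _ => by
      rw [Complex.exp_add, Complex.exp_log (by exact_mod_cast hRpos.ne'), Function.comp_apply, hFc]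
  have hc01 : c 1 = c 0 := by simp [c, Complex.exp_two_pi_mul_I]
  rw [h1] at h2
  simp [hc01, Real.pi_ne_zero] at h2

theorem exists_sphere_chart (q : Metric.sphere (0 : EuclideanSpace ℝ (Fin 3)) 1) :
    ∃ (φ : Metric.sphere (0 : EuclideanSpace ℝ (Fin 3)) 1 → ℂ)
      (ψ : ℂ → Metric.sphere (0 : EuclideanSpace ℝ (Fin 3)) 1),
      ContinuousOn φ {q}ᶜ ∧ Continuous ψ ∧ (∀ z, ψ z ≠ q) ∧ (∀ z, φ (ψ z) = z) ∧
        ∀ y, y ≠ q → ψ (φ y) = y := by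
  have : Fact (Module.finrank ℝ (EuclideanSpace ℝ (Fin 3)) = 2 + 1) :=
    ⟨finrank_euclideanSpace_fin⟩
  let e := stereographic' 2 q
  let c := Complex.orthonormalBasisOneI.repr
  have hs : e.source = {q}ᶜ := stereographic'_source q
  have ht (z : ℂ) : c z ∈ e.target := by simp [e]
  refine ⟨fun y => c.symm (e y), fun z => e.symm (c z), ?_, ?_, fun z => ?_, fun z => ?_,
    fun y hy => ?_⟩
  · exact c.symm.continuous.comp_continuousOn (hs ▸ e.continuousOn)
  · exact e.continuousOn_symm.comp_continuous c.continuous ht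
  · have := e.map_target (ht z)
    rwa [hs] at this
  · simp [e.right_inv (ht z)]
  · have : y ∈ e.source := by simpa [hs] using hy
    simp [e.left_inv this]

/-- A closed subset with continuous logarithms does not separate the sphere. -/
theorem HasContinuousLogs.not_separating {Y : Type*} [TopologicalSpace Y]
    (h : Y ≃ₜ Metric.sphere (0 : EuclideanSpace ℝ (Fin 3)) 1) {X U W : Set Y}
    (hlog : HasContinuousLogs X) (hU : IsOpen U) (hW : IsOpen W) (hUW : Disjoint U W)
    (hX : X = (U ∪ W)ᶜ) (hUne : U.Nonempty) (hWne : W.Nonempty) : False := by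
  obtain ⟨p, hp⟩ := hUne
  obtain ⟨q, hq⟩ := hWne
  obtain ⟨φ₀, ψ₀, hφ₀, hψ₀, hψq, hφψ, hψφ⟩ := exists_sphere_chart (h q)
  let φ : Y → ℂ := fun y => φ₀ (h y)
  let ψ : ℂ → Y := fun z => h.symm (ψ₀ z)
  have hψ : Continuous ψ := h.symm.continuous.comp hψ₀
  have hφ : ContinuousOn φ {q}ᶜ := hφ₀.comp h.continuous.continuousOn fun y hy => by
    simpa using hy
  have h1 (z : ℂ) : φ (ψ z) = z := by simp [φ, ψ, hφψ]
  have h2 (y : Y) (hy : y ≠ q) : ψ (φ y) = y := by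
    simp [φ, ψ, hψφ (h y) (h.injective.ne hy)]
  have hqW {s : Set Y} (hs : Disjoint s W) : s ⊆ {q}ᶜ := fun y hy hyq =>
    Set.disjoint_left.1 hs hy (by rwa [hyq])
  have hXW : Disjoint X W := by
    rw [hX]
    exact Set.disjoint_left.2 fun y hy hyW => hy (Or.inr hyW)
  have hXcl : IsClosed X := hX ▸ (hU.union hW).isClosed_compl
  have hlog' : HasContinuousLogs (ψ ⁻¹' X) :=
    hlog.of_retract (hφ.mono (hqW hXW)) (fun y hy => by
      rwa [Set.mem_preimage, h2 y (hqW hXW hy)]) hψ.continuousOn (fun z hz => hz) fun z _ => h1 z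
  have : CompactSpace Y := h.symm.compactSpace
  have hWc : Wᶜ ⊆ {q}ᶜ := hqW disjoint_compl_left
  have himg : φ '' Wᶜ = ψ ⁻¹' Wᶜ := by
    ext z
    constructor
    · rintro ⟨y, hy, rfl⟩
      rwa [Set.mem_preimage, h2 y (hWc hy)]
    · exact fun hz => ⟨ψ z, hz, h1 z⟩
  have hZ : IsCompact (ψ ⁻¹' Wᶜ) :=
    himg ▸ (hW.isClosed_compl.isCompact.image_of_continuousOn (hφ.mono hWc))
  have hdiff : ψ ⁻¹' Wᶜ \ ψ ⁻¹' X = ψ ⁻¹' U := by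
    rw [← Set.preimage_sdiff]
    congr 1
    ext y
    have : y ∈ U → y ∉ W := fun h => Set.disjoint_left.1 hUW h
    simp only [hX, Set.mem_sdiff, Set.mem_compl_iff, Set.mem_union]
    tauto
  refine hlog'.not_isOpen_diff hZ (hXcl.preimage hψ) (hdiff ▸ hU.preimage hψ) (p := φ p) ?_
  rwa [hdiff, Set.mem_preimage, h2 p (hqW hUW hp)]

theorem HasContinuousLogs.of_image {Y Z : Type*} [TopologicalSpace Y] [TopologicalSpace Z]
    {i : Y → Z} (hi : Topology.IsEmbedding i) {X : Set Y} (h : HasContinuousLogs (i '' X)) :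
    HasContinuousLogs X := by
  rcases isEmpty_or_nonempty Y with hY | hY
  · exact fun g _ _ => ⟨g, by rw [Set.eq_empty_of_isEmpty X]; simp⟩
  · refine h.of_retract (φ := Function.invFun i) (ψ := i) ?_ ?_ hi.continuous.continuousOn
      (Set.mapsTo_image i X) fun y _ => Function.leftInverse_invFun hi.injective y
    · rw [hi.isInducing.continuousOn_iff]
      refine continuousOn_id.congr ?_
      rintro _ ⟨y, -, rfl⟩
      simp [Function.leftInverse_invFun hi.injective y]
    · rintro _ ⟨y, hy, rfl⟩
      rwa [Function.leftInverse_invFun hi.injective y]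

section Realization

variable {V : Type*}

/-- Closure under passing to nonempty subsets. -/
def DownClosed (T : Set (Finset V)) : Prop :=
  ∀ σ ∈ T, ∀ τ : Finset V, τ ⊆ σ → τ.Nonempty → τ ∈ T

theorem DownClosed.sep_subset {T : Set (Finset V)} (hT : DownClosed T) (W : Finset V) :
    DownClosed {σ | σ ∈ T ∧ σ ⊆ W} :=
  fun _ hσ τ hτ hne => ⟨hT _ hσ.1 τ hτ hne, hτ.trans hσ.2⟩

theorem DownClosed.sep_insert [DecidableEq V] {T : Set (Finset V)} (hT : DownClosed T) (b : V) :
    DownClosed {σ | σ.Nonempty ∧ insert b σ ∈ T} :=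
  fun _ hσ _ hτ hne => ⟨hne, hT _ hσ.2 _ (Finset.insert_subset_insert b hτ) (by simp)⟩

variable [Fintype V]

/-- The set of vertices with nonzero barycentric coordinate. -/
noncomputable def coordSupport (x : V → ℝ) : Finset V := Finset.univ.filter fun v => x v ≠ 0

@[simp]
theorem mem_coordSupport {x : V → ℝ} {v : V} : v ∈ coordSupport x ↔ x v ≠ 0 := by
  simp [coordSupport]

/-- The points of the standard simplex whose support belongs to `T`. -/
def realization (T : Set (Finset V)) : Set (V → ℝ) :=
  {x | (∀ v, 0 ≤ x v) ∧ ∑ v, x v = 1 ∧ coordSupport x ∈ T}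

theorem coordSupport_nonempty {x : V → ℝ} (hx : ∑ v, x v = 1) : (coordSupport x).Nonempty := by
  by_contra h
  rw [Finset.not_nonempty_iff_eq_empty] at h
  have : ∀ v, x v = 0 := fun v => by
    by_contra hv
    have : v ∈ coordSupport x := mem_coordSupport.2 hv
    simp [h] at this
  simp [this] at hx

theorem isClosed_realization {T : Set (Finset V)} (hT : DownClosed T) :
    IsClosed (realization T) := by
  have : realization T = ⋃ σ ∈ T, {x : V → ℝ | (∀ v, 0 ≤ x v) ∧ ∑ v, x v = 1 ∧
      ∀ v, v ∉ σ → x v = 0} := by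
    ext x
    simp only [Set.mem_iUnion, realization, Set.mem_ofPred_eq, exists_prop]
    constructor
    · rintro ⟨h0, h1, h2⟩
      exact ⟨_, h2, h0, h1, fun v hv => by simpa using hv⟩
    · rintro ⟨σ, hσ, h0, h1, h2⟩
      refine ⟨h0, h1, hT σ hσ _ (fun v hv => ?_) (coordSupport_nonempty h1)⟩
      by_contra hvσ
      exact mem_coordSupport.1 hv (h2 v hvσ)
  rw [this]
  refine (Set.toFinite T).isClosed_biUnion fun σ _ => ?_
  simp only [Set.ofPred_and, Set.ofPred_forall]
  refine (isClosed_iInter fun v => isClosed_le continuous_const (continuous_apply v)).inter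
    ((isClosed_eq (by fun_prop) continuous_const).inter
      (isClosed_iInter fun v => isClosed_iInter fun _ =>
        isClosed_eq (continuous_apply v) continuous_const))

variable [DecidableEq V]

@[simp]
theorem coordSupport_single (a : V) : coordSupport (Pi.single a 1 : V → ℝ) = {a} := by
  ext v
  simp [Pi.single_apply]

theorem single_mem_realization {T : Set (Finset V)} {a : V} (ha : {a} ∈ T) :
    (Pi.single a 1 : V → ℝ) ∈ realization T := by
  refine ⟨fun v => ?_, by simp, by simpa using ha⟩
  rw [Pi.single_apply]
  split_ifs <;> norm_num

theorem eq_single_of_coordSupport {x : V → ℝ} (hx : ∑ v, x v = 1) {a : V}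
    (h : coordSupport x = {a}) : x = Pi.single a 1 := by
  have h0 (v : V) (hv : v ≠ a) : x v = 0 := by
    by_contra hxv
    have : v ∈ coordSupport x := mem_coordSupport.2 hxv
    rw [h, Finset.mem_singleton] at this
    exact hv this
  have ha : x a = 1 := by
    rw [← hx]
    exact (Fintype.sum_eq_single a h0).symm
  ext v
  by_cases hv : v = a
  · subst hv; simp [ha]
  · simp [hv, h0 v hv]

theorem coordSupport_combination_subset (b : V) (x : V → ℝ) (s t : ℝ) :
    coordSupport (s • (Pi.single b 1 : V → ℝ) + t • x) ⊆ insert b (coordSupport x) := by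
  intro v hv
  rw [Finset.mem_insert, mem_coordSupport]
  by_contra! h
  refine mem_coordSupport.1 hv ?_
  simp [h.1, h.2]

theorem starConvex_realization {T : Set (Finset V)} (hT : DownClosed T) {b : V}
    (hb : ∀ σ ∈ T, insert b σ ∈ T) : StarConvex ℝ (Pi.single b 1) (realization T) := by
  intro x hx s t hs ht hst
  have hsum : ∑ v, (s • (Pi.single b 1 : V → ℝ) + t • x) v = 1 := by
    simp [Finset.sum_add_distrib, ← Finset.mul_sum, hx.2.1, hst]
  refine ⟨fun v => ?_, hsum, hT _ (hb _ hx.2.2) _ (coordSupport_combination_subset b x s t)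
    (coordSupport_nonempty hsum)⟩
  have h1 : (0 : ℝ) ≤ (Pi.single b 1 : V → ℝ) v := by
    rw [Pi.single_apply]
    split_ifs <;> norm_num
  simpa using add_nonneg (mul_nonneg hs h1) (mul_nonneg ht (hx.1 v))

/-- Adjacency in the `1`-skeleton after deletion of `b`. -/
def AdjAvoiding (T : Set (Finset V)) (b : V) (x y : V) : Prop :=
  x ≠ b ∧ y ≠ b ∧ {x, y} ∈ T

/-- If the `1`-skeleton of `T` has no cycles, then `T` has continuous logarithms. -/
theorem hasContinuousLogs_of_acyclic {T : Set (Finset V)} (hT : DownClosed T)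
    (hacyc : ∀ a b c, a ≠ b → c ≠ b → {b, a} ∈ T → {b, c} ∈ T →
      Relation.ReflTransGen (AdjAvoiding T b) a c → a = c) (W : Finset V) :
    HasContinuousLogs (realization {σ | σ ∈ T ∧ σ ⊆ W}) := by
  classical
  induction W using Finset.induction_on with
  | empty =>
    convert HasContinuousLogs.of_finite (Set.finite_empty (α := V → ℝ))
    ext x
    simp only [Set.mem_empty_iff_false, iff_false]
    rintro ⟨-, h1, -, h2⟩
    obtain ⟨v, hv⟩ := coordSupport_nonempty h1
    simpa using h2 hv
  | insert b W hbW ih =>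
    have hTb := hT.sep_subset (insert b W)
    have hAcl := isClosed_realization (hT.sep_subset W)
    have hBd := hTb.sep_insert b
    have hBcl := isClosed_realization hBd
    have hB : HasContinuousLogs
        (realization {σ | σ.Nonempty ∧ insert b σ ∈ {σ | σ ∈ T ∧ σ ⊆ insert b W}}) :=
      HasContinuousLogs.of_starConvex
        (starConvex_realization hBd (b := b) fun σ hσ => ⟨by simp, by simpa using hσ.2⟩)
    set A := realization {σ | σ ∈ T ∧ σ ⊆ W}
    set B := realization {σ | σ.Nonempty ∧ insert b σ ∈ {σ | σ ∈ T ∧ σ ⊆ insert b W}}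
    have hunion : realization {σ | σ ∈ T ∧ σ ⊆ insert b W} = A ∪ B := by
      ext x
      constructor
      · rintro ⟨h0, h1, h2, h3⟩
        by_cases hb : b ∈ coordSupport x
        · exact Or.inr ⟨h0, h1, ⟨b, hb⟩, by simpa [Finset.insert_eq_of_mem hb] using ⟨h2, h3⟩⟩
        · exact Or.inl ⟨h0, h1, h2, (Finset.subset_insert_iff_of_notMem hb).1 h3⟩
      · rintro (⟨h0, h1, h2, h3⟩ | ⟨h0, h1, h2, h3⟩)
        · exact ⟨h0, h1, h2, h3.trans (Finset.subset_insert b W)⟩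
        · exact ⟨h0, h1, hTb _ h3 _ (Finset.subset_insert b _) h2⟩
    rw [hunion]
    intro g hg hg0
    obtain ⟨lA, hlA, hlAe⟩ := ih g (hg.mono Set.subset_union_left) fun x hx => hg0 x (Or.inl hx)
    obtain ⟨lB, hlB, hlBe⟩ := hB g (hg.mono Set.subset_union_right) fun x hx => hg0 x (Or.inr hx)
    let N (w a : V) : Prop := a ∈ W ∧ {b, a} ∈ T ∧ Relation.ReflTransGen (AdjAvoiding T b) a w
    have hsymm : Std.Symm (AdjAvoiding T b) :=
      ⟨fun x y h => ⟨h.2.1, h.1, by rw [Finset.pair_comm]; exact h.2.2⟩⟩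
    have hNuniq (w a c : V) (ha : N w a) (hc : N w c) : a = c :=
      hacyc a b c (fun h => hbW (h ▸ ha.1)) (fun h => hbW (h ▸ hc.1)) ha.2.1 hc.2.1
        (ha.2.2.trans (Relation.ReflTransGen.stdSymm.symm _ _ hc.2.2))
    let d (a : V) : ℂ := lB (Pi.single a 1) - lA (Pi.single a 1)
    let k (w : V) : ℂ := if h : ∃ a, N w a then d h.choose else 0
    have hk (w a : V) (ha : N w a) : k w = d a := by
      have hex : ∃ a, N w a := ⟨a, ha⟩
      simp only [k, dif_pos hex]
      rw [hNuniq w _ _ hex.choose_spec ha]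
    have hkadj (x y : V) (hxy : AdjAvoiding T b x y) : k x = k y := by
      by_cases hex : ∃ a, N x a
      · obtain ⟨a, ha⟩ := hex
        rw [hk x a ha, hk y a ⟨ha.1, ha.2.1, ha.2.2.tail hxy⟩]
      · have hey : ¬ ∃ a, N y a := fun ⟨a, ha⟩ =>
          hex ⟨a, ha.1, ha.2.1, ha.2.2.tail (hsymm.symm _ _ hxy)⟩
        simp only [k, dif_neg hex, dif_neg hey]
    have hdexp (a : V) (haW : a ∈ W) (ha : {b, a} ∈ T) : Complex.exp (d a) = 1 := by
      have h1 : {a} ∈ T := hT _ ha _ (by simp) (by simp)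
      have hA : (Pi.single a 1 : V → ℝ) ∈ A := single_mem_realization ⟨h1, by simpa using haW⟩
      have hB : (Pi.single a 1 : V → ℝ) ∈ B := by
        refine single_mem_realization ⟨by simp, by simpa using ha, ?_⟩
        exact Finset.insert_subset_insert b (by simpa using haW)
      simp only [d]
      rw [Complex.exp_sub, hlAe _ hA, hlBe _ hB, div_self (hg0 _ (Or.inl hA))]
    have hkexp (w : V) : Complex.exp (k w) = 1 := by
      by_cases hex : ∃ a, N w a
      · obtain ⟨a, ha⟩ := hex
        rw [hk w a ha, hdexp a ha.1 ha.2.1]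
      · simp only [k, dif_neg hex, Complex.exp_zero]
    let κ (x : V → ℝ) : ℂ := ∑ w, (x w : ℂ) * k w
    have hκ (x : V → ℝ) (hx : x ∈ A) (w : V) (hw : w ∈ coordSupport x) : κ x = k w := by
      have : ∀ w' : V, (x w' : ℂ) * k w' = x w' * k w := fun w' => by
        by_cases hw' : x w' = 0
        · simp [hw']
        · have hw'' : w' ∈ coordSupport x := mem_coordSupport.2 hw'
          rw [hkadj w' w ⟨fun h => hbW (h ▸ hx.2.2.2 hw''), fun h => hbW (h ▸ hx.2.2.2 hw),
            hT _ hx.2.2.1 _ (by simp [Finset.insert_subset_iff, hw', mem_coordSupport.1 hw])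
              (by simp)⟩]
      simp only [κ, this, ← Finset.sum_mul]
      rw [← Complex.ofReal_sum, hx.2.1]
      simp
    have hAB (x : V → ℝ) (hxA : x ∈ A) (hxB : x ∈ B) : lA x + κ x = lB x := by
      obtain ⟨a, ha⟩ := coordSupport_nonempty hxA.2.1
      have hmem (c : V) (hc : c ∈ coordSupport x) : c ≠ b ∧ {b, c} ∈ T :=
        ⟨fun h => hbW (h ▸ hxA.2.2.2 hc), hT _ hxB.2.2.2.1 _
          (by simp [Finset.insert_subset_iff, mem_coordSupport.1 hc]) (by simp)⟩
      have hsupp : coordSupport x = {a} := by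
        refine Finset.eq_singleton_iff_unique_mem.2 ⟨ha, fun c hc => ?_⟩
        refine hacyc c b a (hmem c hc).1 (hmem a ha).1 (hmem c hc).2 (hmem a ha).2
          (Relation.ReflTransGen.single ⟨(hmem c hc).1, (hmem a ha).1, hT _ hxA.2.2.1 _ ?_ ?_⟩)
        · simp [Finset.insert_subset_iff, mem_coordSupport.1 hc, mem_coordSupport.1 ha]
        · simp
      rw [hκ x hxA a ha, hk a a ⟨hxA.2.2.2 ha, (hmem a ha).2, .refl⟩,
        eq_single_of_coordSupport hxA.2.1 hsupp]
      simp only [d]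
      ring
    let l (x : V → ℝ) : ℂ := if x b = 0 then lA x + κ x else lB x
    have hlA' : Set.EqOn l (fun x => lA x + κ x) A := fun x hx => by
      have : x b = 0 := by
        by_contra h
        exact hbW (hx.2.2.2 (mem_coordSupport.2 h))
      simp [l, this]
    have hlB' : Set.EqOn l lB B := fun x hx => by
      by_cases h : x b = 0
      · have hxA : x ∈ A := by
          refine ⟨hx.1, hx.2.1, (hTb _ hx.2.2.2 _ (Finset.subset_insert b _) hx.2.2.1).1, ?_⟩
          refine (Finset.subset_insert_iff_of_notMem (by simpa using h)).1
            ((Finset.subset_insert b _).trans hx.2.2.2.2)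
        simpa [l, h] using hAB x hxA hx
      · simp [l, h]
    refine ⟨l, ?_, ?_⟩
    · refine ContinuousOn.union_of_isClosed ?_ (hlB.congr hlB') hAcl hBcl
      refine ContinuousOn.congr (hlA.add (Continuous.continuousOn ?_)) hlA'
      fun_prop
    · rintro x (hx | hx)
      · obtain ⟨w, hw⟩ := coordSupport_nonempty hx.2.1
        rw [hlA' hx, Complex.exp_add, hlAe x hx, hκ x hx w hw, hkexp, mul_one]
      · rw [hlB' hx, hlBe x hx]

end Realization

section Increments

variable {V : Type*}

/-- The combinatorial properties of the angular increments `θ w a b`, seen from the vertex `w`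
along the edge `a b`, of a planar drawing in which disjoint edges do not meet. -/
structure IsIncrementSystem (E : V → V → Prop) (P : V → ℂ) (θ : V → V → V → ℂ) : Prop where
  symm : ∀ a b, E a b → E b a
  anti : ∀ w a b c, E a b → E w c → w ≠ a → w ≠ b → θ w b a = -θ w a b
  cell : ∀ a b c d, E a b → E c d → a ≠ c → a ≠ d → b ≠ c → b ≠ d →
    θ c a b + θ b c d = θ d a b + θ a c d
  exp : ∀ w a b c, E a b → E w c → w ≠ a → w ≠ b →
    Complex.exp (θ w a b) = (P b - P w) / (P a - P w)
  inj : ∀ a b c d, E a c → E b d → a ≠ b → P a - P b ≠ 0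

namespace IsIncrementSystem

variable {E : V → V → Prop} {P : V → ℂ} {θ : V → V → V → ℂ}

/-- The winding number around a triangle is constant on each component of the rest of the
graph. -/
theorem triangle_eq (h : IsIncrementSystem E P θ) {a b c w w' : V} (hab : E a b) (hbc : E b c)
    (hca : E c a) (hw : Relation.ReflTransGen
      (fun x y => E x y ∧ (x ≠ a ∧ x ≠ b ∧ x ≠ c) ∧ (y ≠ a ∧ y ≠ b ∧ y ≠ c)) w w') :
    θ w a b + θ w b c + θ w c a = θ w' a b + θ w' b c + θ w' c a := by
  induction hw with
  | refl => rfl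
  | tail _ hs ih =>
    obtain ⟨he, ⟨h1, h2, h3⟩, h4, h5, h6⟩ := hs
    rw [ih]
    linear_combination -h.cell _ _ _ _ he hab h1 h2 h4 h5 - h.cell _ _ _ _ he hbc h2 h3 h5 h6
      - h.cell _ _ _ _ he hca h3 h1 h6 h4

theorem swap_sub_eq (h : IsIncrementSystem E P θ) {u x y w w' : V} (hux : E u x) (hxy : E x y)
    (hyu : E y u) (hw : E u w) (hw' : E u w') (hux' : u ≠ x) (huy' : u ≠ y)
    (hwx : w ≠ x) (hwy : w ≠ y) (hwu : w ≠ u) (hwx' : w' ≠ x) (hwy' : w' ≠ y) (hwu' : w' ≠ u)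
    (hconn : Relation.ReflTransGen
      (fun a b => E a b ∧ (a ≠ u ∧ a ≠ x ∧ a ≠ y) ∧ (b ≠ u ∧ b ≠ x ∧ b ≠ y)) w w') :
    (θ x u w - θ w u x) - (θ y u w - θ w u y) =
      (θ x u w' - θ w' u x) - (θ y u w' - θ w' u y) := by
  have ht := h.triangle_eq hux hxy hyu hconn
  have h1 := h.cell u w x y hw hxy hux' huy' hwx hwy
  have h2 := h.cell u w' x y hw' hxy hux' huy' hwx' hwy'
  have h3 := h.anti w y u u hyu (h.symm _ _ hw) hwy hwu
  have h4 := h.anti w' y u u hyu (h.symm _ _ hw') hwy' hwu'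
  rw [h3, h4]
  linear_combination h1 - h2 - ht

theorem exp_swap (h : IsIncrementSystem E P θ) {u x w : V} (hx : E u x) (hw : E u w)
    (hxu : x ≠ u) (hwu : w ≠ u) (hxw : x ≠ w) :
    Complex.exp (θ x u w - θ w u x) = -((P u - P w) / (P u - P x)) := by
  have hx' := h.symm _ _ hx
  have hw' := h.symm _ _ hw
  have h1 := h.inj _ _ _ _ hw' hx' hxw.symm
  have h2 := h.inj _ _ _ _ hx hx' hxu.symm
  have h3 := h.inj _ _ _ _ hw hw' hwu.symm
  have h4 := h.inj _ _ _ _ hx' hw' hxw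
  rw [Complex.exp_sub, h.exp x u w u hw hx' hxu hxw, h.exp w u x u hx hw' hwu hxw.symm]
  field_simp
  ring

/-- A vertex `v` adjacent to `u` cannot lie outside a cycle in the link of `u`. -/
theorem no_cycle (h : IsIncrementSystem E P θ) {u v : V} {T : V → V → Prop} (huv : E u v)
    (hvu : v ≠ u)
    (hT : ∀ x y, T x y → E u x ∧ E x y ∧ E y u ∧ x ≠ u ∧ y ≠ u ∧ v ≠ x ∧ v ≠ y)
    (hconn : ∀ x y w, T x y → E u w → w ≠ u → w ≠ x → w ≠ y → Relation.ReflTransGen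
      (fun a b => E a b ∧ (a ≠ u ∧ a ≠ x ∧ a ≠ y) ∧ (b ≠ u ∧ b ≠ x ∧ b ≠ y)) v w)
    {a b c : V} (hab : a ≠ b) (hcb : c ≠ b) (hba : T b a) (hbc : T b c)
    (hac : Relation.ReflTransGen (fun x y => x ≠ b ∧ y ≠ b ∧ T x y) a c) : a = c := by
  by_contra hne
  obtain ⟨hub, -, hau, hbu', hau', -, -⟩ := hT b a hba
  obtain ⟨-, -, hcu, -, hcu', -, -⟩ := hT b c hbc
  have hua := h.symm _ _ hau
  have huc := h.symm _ _ hcu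
  have key (x y w : V) (hxy : T x y) (hw : E u w) (hwu : w ≠ u) (hwx : w ≠ x) (hwy : w ≠ y) :
      (θ x u v - θ v u x) - (θ y u v - θ v u y) = (θ x u w - θ w u x) - (θ y u w - θ w u y) := by
    obtain ⟨h1, h2, h3, h4, h5, h6, h7⟩ := hT x y hxy
    exact h.swap_sub_eq h1 h2 h3 huv hw h4.symm h5.symm h6 h7 hvu hwx hwy hwu
      (hconn x y w hxy hw hwu hwx hwy)
  have hpath : (θ a u v - θ v u a) - (θ c u v - θ v u c) =
      (θ a u b - θ b u a) - (θ c u b - θ b u c) := by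
    clear hne hcb hbc hcu hcu' huc
    induction hac with
    | refl => ring
    | tail _ hs ih =>
      linear_combination ih + key _ _ b hs.2.2 hub hbu' hs.1.symm hs.2.1.symm
  have h1 := key b a c hba huc hcu' hcb (Ne.symm hne)
  have h2 := key b c a hbc hua hau' hab hne
  have hzero : (θ a u b - θ b u a) + (θ b u c - θ c u b) + (θ c u a - θ a u c) = 0 := by
    linear_combination (-1 / 2 : ℂ) * (h1 - h2 + hpath)
  have hexp := congrArg Complex.exp hzero
  rw [Complex.exp_add, Complex.exp_add, h.exp_swap hua hub hau' hbu' hab,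
    h.exp_swap hub huc hbu' hcu' hcb.symm, h.exp_swap huc hua hcu' hau' (Ne.symm hne),
    Complex.exp_zero] at hexp
  have ha0 := h.inj _ _ _ _ hua hau hau'.symm
  have hb0 := h.inj _ _ _ _ hub (h.symm _ _ hub) hbu'.symm
  have hc0 := h.inj _ _ _ _ huc hcu hcu'.symm
  field_simp at hexp
  norm_num at hexp

end IsIncrementSystem

end Increments

section Drawing

variable {V : Type*} [DecidableEq V]

/-- The edge from `a` to `b` in the standard simplex, parametrized by `[0, 1]`. -/
noncomputable def edgePath (a b : V) (t : ℝ) : V → ℝ :=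
  (1 - t) • Pi.single a 1 + t • Pi.single b 1

theorem continuous_edgePath (a b : V) : Continuous (edgePath a b) := by
  unfold edgePath
  fun_prop

theorem edgePath_zero (a b : V) : edgePath a b 0 = Pi.single a 1 := by simp [edgePath]

theorem edgePath_one (a b : V) : edgePath a b 1 = Pi.single b 1 := by simp [edgePath]

theorem edgePath_reverse (a b : V) (t : ℝ) : edgePath b a t = edgePath a b (1 - t) := by
  simp [edgePath, add_comm]

variable [Fintype V]

theorem coordSupport_edgePath_subset (a b : V) (t : ℝ) :
    coordSupport (edgePath a b t) ⊆ {a, b} := by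
  simpa [edgePath] using coordSupport_combination_subset a (Pi.single b 1) (1 - t) t

theorem edgePath_mem_realization {T : Set (Finset V)} (hT : DownClosed T) {a b : V}
    (hab : {a, b} ∈ T) {t : ℝ} (ht : t ∈ Set.Icc (0 : ℝ) 1) : edgePath a b t ∈ realization T := by
  have hsum : ∑ v, edgePath a b t v = 1 := by
    simp [edgePath, Finset.sum_add_distrib, ← Finset.mul_sum]
  refine ⟨fun v => ?_, hsum, hT _ hab _ (coordSupport_edgePath_subset a b t)
    (coordSupport_nonempty hsum)⟩
  have h (c : V) : (0 : ℝ) ≤ (Pi.single c 1 : V → ℝ) v := by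
    rw [Pi.single_apply]
    split_ifs <;> norm_num
  exact add_nonneg (mul_nonneg (sub_nonneg.2 ht.2) (h a)) (mul_nonneg ht.1 (h b))

/-- An injective planar drawing gives an increment system. -/
theorem isIncrementSystem_of_injOn {T : Set (Finset V)} (hT : DownClosed T) {F : (V → ℝ) → ℂ}
    (hF : ContinuousOn F (realization T)) (hinj : Set.InjOn F (realization T)) :
    IsIncrementSystem (fun a b => {a, b} ∈ T) (fun a => F (Pi.single a 1))
      (fun w a b => logIncrement fun t => F (edgePath a b t) - F (Pi.single w 1)) := by
  have hcont {a b : V} (hab : {a, b} ∈ T) :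
      ContinuousOn (fun t => F (edgePath a b t)) (Set.Icc 0 1) :=
    hF.comp (continuous_edgePath a b).continuousOn fun t => edgePath_mem_realization hT hab
  have hdisj {a b c d : V} (hab : {a, b} ∈ T) (hcd : {c, d} ∈ T) (hac : a ≠ c) (had : a ≠ d)
      (hbc : b ≠ c) (hbd : b ≠ d) {s t : ℝ} (hs : s ∈ Set.Icc (0 : ℝ) 1)
      (ht : t ∈ Set.Icc (0 : ℝ) 1) : F (edgePath a b s) ≠ F (edgePath c d t) := by
    intro h
    have hs' := edgePath_mem_realization hT hab hs
    have heq := hinj hs' (edgePath_mem_realization hT hcd ht) h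
    obtain ⟨x, hx⟩ := coordSupport_nonempty hs'.2.1
    have h1 := coordSupport_edgePath_subset a b s hx
    have h2 := coordSupport_edgePath_subset c d t (heq ▸ hx)
    simp only [Finset.mem_insert, Finset.mem_singleton] at h1 h2
    grind
  have hvert {a b : V} (hab : {a, b} ∈ T) : {a} ∈ T := hT _ hab _ (by simp) (by simp)
  have hne {a b w c : V} (hab : {a, b} ∈ T) (hwc : {w, c} ∈ T) (hwa : w ≠ a) (hwb : w ≠ b)
      {t : ℝ} (ht : t ∈ Set.Icc (0 : ℝ) 1) : F (edgePath a b t) - F (Pi.single w 1) ≠ 0 := by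
    have := hdisj hab (by simpa using hvert hwc) hwa.symm hwa.symm hwb.symm hwb.symm ht
      (c := w) (d := w) (Set.left_mem_Icc.2 zero_le_one)
    rw [edgePath_zero] at this
    exact sub_ne_zero.2 this
  refine ⟨fun a b hab => ?_, fun w a b c hab hwc hwa hwb => ?_,
    fun a b c d hab hcd hac had hbc hbd => ?_, fun w a b c hab hwc hwa hwb => ?_,
    fun a b c d hac hbd hab => ?_⟩
  · rwa [Finset.pair_comm]
  · simp only [edgePath_reverse a b]
    exact logIncrement_reverse ((hcont hab).sub continuousOn_const) fun t ht =>
      hne hab hwc hwa hwb ht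
  · have := logIncrement_square (hcont hab) (hcont hcd) fun s hs t ht =>
      hdisj hab hcd hac had hbc hbd hs ht
    simpa only [edgePath_zero, edgePath_one] using this
  · have := exp_logIncrement (g := fun t => F (edgePath a b t) - F (Pi.single w 1))
      ((hcont hab).sub continuousOn_const) fun t ht => hne hab hwc hwa hwb ht
    simpa only [edgePath_zero, edgePath_one] using this
  · refine sub_ne_zero.2 fun h => hab ?_
    have := hinj (single_mem_realization (hvert hac)) (single_mem_realization (hvert hbd)) h
    by_contra hne
    have h1 := congrFun this a
    simp [hne] at h1

end Drawing

section Sphere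

theorem IsComplex.downClosed {V : Type} [DecidableEq V] {K : Finset (Finset V)} (hK : IsComplex K) :
    DownClosed (K : Set (Finset V)) :=
  fun σ hσ τ hτ hne => hK.2 σ hσ τ hτ hne

variable {V : Type} [Fintype V]

namespace GeomRep

variable {K : Finset (Finset V)}

/-- The barycentric coordinates of a point. -/
def coord (x : GeomRep K) : V → ℝ := x.1

theorem mem_realization (x : GeomRep K) : x.coord ∈ realization (K : Set (Finset V)) :=
  ⟨x.2.1, x.2.2.2.1, x.2.2.2.2⟩

theorem exists_of_mem_realization {x : V → ℝ} (hx : x ∈ realization (K : Set (Finset V))) :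
    ∃ y : GeomRep K, y.coord = x := by
  refine ⟨⟨x, hx.1, fun v => ?_, hx.2.1, hx.2.2⟩, rfl⟩
  rw [← hx.2.1]
  exact Finset.single_le_sum (fun w _ => hx.1 w) (Finset.mem_univ v)

theorem isEmbedding_coord : Topology.IsEmbedding (coord : GeomRep K → V → ℝ) :=
  Topology.IsEmbedding.subtypeVal

theorem continuous_coord (v : V) : Continuous fun x : GeomRep K => x.coord v :=
  (continuous_apply v).comp isEmbedding_coord.continuous

theorem image_coord {T : Set (Finset V)} (hT : T ⊆ K) :
    coord '' {x : GeomRep K | coordSupport x.coord ∈ T} = realization T := by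
  ext x
  constructor
  · rintro ⟨y, hy, rfl⟩
    exact ⟨y.2.1, y.2.2.2.1, hy⟩
  · intro hx
    obtain ⟨y, rfl⟩ := exists_of_mem_realization (K := K) ⟨hx.1, hx.2.1, hT hx.2.2⟩
    exact ⟨y, hx.2.2, rfl⟩

theorem image_coord_univ :
    coord '' (Set.univ : Set (GeomRep K)) = realization (K : Set (Finset V)) := by
  rw [← image_coord subset_rfl]
  congr 1
  ext x
  exact ⟨fun _ => x.mem_realization.2.2, fun _ => trivial⟩

theorem hasContinuousLogs {T : Set (Finset V)} (hT : T ⊆ K)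
    (h : HasContinuousLogs (realization T)) :
    HasContinuousLogs {x : GeomRep K | coordSupport x.coord ∈ T} :=
  .of_image isEmbedding_coord (by rwa [image_coord hT])

theorem isClosed_setOf_coordSupport {T : Set (Finset V)} (hT : DownClosed T) :
    IsClosed {x : GeomRep K | coordSupport x.coord ∈ T} := by
  have : {x : GeomRep K | coordSupport x.coord ∈ T} = coord ⁻¹' realization T := by
    ext x
    exact ⟨fun hx => ⟨x.2.1, x.2.2.2.1, hx⟩, fun hx => hx.2.2⟩
  rw [this]
  exact (isClosed_realization hT).preimage isEmbedding_coord.continuous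

theorem compactSpace (hK : DownClosed (K : Set (Finset V))) : CompactSpace (GeomRep K) := by
  refine isCompact_univ_iff.1 (isEmbedding_coord.isCompact_iff.2 ?_)
  rw [image_coord_univ]
  refine (isCompact_univ_pi fun _ : V => isCompact_Icc (a := (0 : ℝ)) (b := 1)).of_isClosed_subset
    (isClosed_realization hK) fun x hx v _ => ?_
  obtain ⟨y, rfl⟩ := exists_of_mem_realization hx
  exact ⟨y.2.1 v, y.2.2.1 v⟩

variable [DecidableEq V]

theorem exists_single {a : V} (ha : {a} ∈ K) : ∃ x : GeomRep K, x.coord = Pi.single a 1 :=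
  exists_of_mem_realization (single_mem_realization (by simpa using ha))

end GeomRep

variable [DecidableEq V]

/-- Deleting the vertices of a face does not disconnect the `1`-skeleton of a triangulated
sphere. -/
theorem reflTransGen_avoiding_face {S : Finset (Finset V)} (hS : IsComplex S)
    (h : GeomRep S ≃ₜ Metric.sphere (0 : EuclideanSpace ℝ (Fin 3)) 1) {t : Finset V} (ht : t ∈ S)
    {v w : V} (hv : {v} ∈ S) (hw : {w} ∈ S) (hvt : v ∉ t) (hwt : w ∉ t) :
    Relation.ReflTransGen (fun x y => {x, y} ∈ S ∧ x ∉ t ∧ y ∉ t) v w := by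
  by_contra hcon
  set R : V → V → Prop := fun x y => {x, y} ∈ S ∧ x ∉ t ∧ y ∉ t with hR
  have hTd : DownClosed {σ | σ ∈ (S : Set (Finset V)) ∧ σ ⊆ t} := hS.downClosed.sep_subset t
  obtain ⟨b, hb⟩ := hS.1 t ht
  have hlog := GeomRep.hasContinuousLogs (K := S) (fun σ hσ => hσ.1) <|
    HasContinuousLogs.of_starConvex <| starConvex_realization hTd (b := b) fun σ hσ => by
      have : insert b σ ⊆ t := Finset.insert_subset hb hσ.2
      exact ⟨hS.2 t ht _ this (by simp), this⟩
  have hopen (A : Set V) : IsOpen {x : GeomRep S | ∃ a ∈ A, x.coord a ≠ 0} := by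
    simp only [Set.ofPred_exists, Set.ofPred_and]
    refine isOpen_iUnion fun a => isOpen_const.inter ?_
    exact isOpen_ne_fun (GeomRep.continuous_coord a) continuous_const
  refine hlog.not_separating h (hopen {a | a ∉ t ∧ Relation.ReflTransGen R v a})
    (hopen {a | a ∉ t ∧ ¬ Relation.ReflTransGen R v a}) ?_ ?_ ?_ ?_
  · refine Set.disjoint_left.2 ?_
    rintro x ⟨a, ⟨hat, ha⟩, hxa⟩ ⟨c, ⟨hct, hc⟩, hxc⟩
    refine hc (ha.tail ⟨hS.2 _ x.mem_realization.2.2 _ ?_ (by simp), hat, hct⟩)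
    simp [Finset.insert_subset_iff, hxa, hxc]
  · ext x
    have hxS := x.mem_realization.2.2
    simp only [Set.mem_ofPred_eq, Set.mem_compl_iff, Set.mem_union, not_or, not_exists, not_and,
      not_not, Finset.subset_iff, mem_coordSupport]
    grind
  · obtain ⟨x, hx⟩ := GeomRep.exists_single hv
    exact ⟨x, v, ⟨hvt, .refl⟩, by simp [hx]⟩
  · obtain ⟨x, hx⟩ := GeomRep.exists_single hw
    exact ⟨x, w, ⟨hwt, hcon⟩, by simp [hx]⟩

/-- The link of a vertex `u` of a triangulated sphere contains a cycle as soon as some vertex is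
not adjacent to `u`. -/
theorem exists_cycle_in_link {S : Finset (Finset V)} (hS : IsComplex S)
    (h : GeomRep S ≃ₜ Metric.sphere (0 : EuclideanSpace ℝ (Fin 3)) 1) {u v : V} (hu : {u} ∈ S)
    (hv : {v} ∈ S) (hM : {u, v} ∉ S) {T : Set (Finset V)}
    (hT : T = {σ | σ.Nonempty ∧ u ∉ σ ∧ insert u σ ∈ S}) :
    ∃ a b c, a ≠ b ∧ c ≠ b ∧ {b, a} ∈ T ∧ {b, c} ∈ T ∧
      Relation.ReflTransGen (AdjAvoiding T b) a c ∧ a ≠ c := by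
  by_contra! hcon
  have hTd : DownClosed T := by
    subst hT
    exact fun σ hσ τ hτ hne => ⟨hne, fun hu => hσ.2.1 (hτ hu),
      hS.2 _ hσ.2.2 _ (Finset.insert_subset_insert u hτ) (by simp)⟩
  have hTS : T ⊆ S := by
    subst hT
    exact fun σ hσ => hS.2 _ hσ.2.2 _ (Finset.subset_insert u σ) hσ.1
  have hlog' := hasContinuousLogs_of_acyclic hTd hcon Finset.univ
  simp only [Finset.subset_univ, and_true, Set.ofPred_mem_eq] at hlog'
  have hlog := GeomRep.hasContinuousLogs hTS hlog'
  refine hlog.not_separating h (U := {x | x.coord u ≠ 0})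
    (W := {x | coordSupport x.coord ∈ {σ | σ.Nonempty ∧ insert u σ ∈ S}}ᶜ)
    (isOpen_ne_fun (GeomRep.continuous_coord u) continuous_const)
    (GeomRep.isClosed_setOf_coordSupport (hS.downClosed.sep_insert u)).isOpen_compl ?_ ?_ ?_ ?_
  · refine Set.disjoint_left.2 fun x hx hxW => hxW ⟨coordSupport_nonempty x.mem_realization.2.1, ?_⟩
    rw [Finset.insert_eq_of_mem (mem_coordSupport.2 hx)]
    exact x.mem_realization.2.2
  · subst hT
    ext x
    simp only [Set.mem_ofPred_eq, Set.mem_compl_iff, Set.mem_union, mem_coordSupport]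
    tauto
  · obtain ⟨x, hx⟩ := GeomRep.exists_single hu
    exact ⟨x, by simp [hx]⟩
  · obtain ⟨x, hx⟩ := GeomRep.exists_single hv
    exact ⟨x, by simp [hx, hM]⟩

/-- The graph obtained from the `1`-skeleton of a triangulated sphere by adding a missing edge
has no injective planar drawing. -/
theorem not_injOn_plane {S : Finset (Finset V)} (hS : IsComplex S)
    (h : GeomRep S ≃ₜ Metric.sphere (0 : EuclideanSpace ℝ (Fin 3)) 1) {u v : V} (huv : u ≠ v)
    (hu : {u} ∈ S) (hv : {v} ∈ S) (hM : {u, v} ∉ S) {K : Set (Finset V)} (hK : DownClosed K)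
    (hKe : ∀ a b, {a, b} ∈ K ↔ {a, b} ∈ S ∨ ({a, b} : Finset V) = {u, v})
    {F : (V → ℝ) → ℂ} (hF : ContinuousOn F (realization K)) :
    ¬ Set.InjOn F (realization K) := by
  intro hinj
  have hE := isIncrementSystem_of_injOn hK hF hinj
  obtain ⟨a, b, c, hab, hcb, hba, hbc, hac, hne⟩ := exists_cycle_in_link hS h hu hv hM rfl
  set T := {σ : Finset V | σ.Nonempty ∧ u ∉ σ ∧ insert u σ ∈ S}
  have hT (x y : V) (hxy : {x, y} ∈ T) :
      x ≠ u ∧ y ≠ u ∧ {u, x, y} ∈ S ∧ v ∉ ({u, x, y} : Finset V) := by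
    have h3 : {u, x, y} ∈ S := hxy.2.2
    have hu' := hxy.2.1
    simp only [Finset.mem_insert, Finset.mem_singleton, not_or] at hu'
    refine ⟨Ne.symm hu'.1, Ne.symm hu'.2, h3, fun hv' => hM (hS.2 _ h3 _ ?_ (by simp))⟩
    simp only [Finset.insert_subset_iff, Finset.singleton_subset_iff]
    exact ⟨by simp, hv'⟩
  refine hne (hE.no_cycle (T := fun x y => ({x, y} : Finset V) ∈ T) ((hKe u v).2 (Or.inr rfl))
    huv.symm
    (fun x y hxy => ?_) (fun x y w hxy huw hwu hwx hwy => ?_) hab hcb hba hbc hac)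
  · obtain ⟨hx, hy, h3, hv'⟩ := hT x y hxy
    simp only [Finset.mem_insert, Finset.mem_singleton, not_or] at hv'
    refine ⟨(hKe _ _).2 (Or.inl (hS.2 _ h3 _ ?_ (by simp))),
      (hKe _ _).2 (Or.inl (hS.2 _ h3 _ ?_ (by simp))),
      (hKe _ _).2 (Or.inl (hS.2 _ h3 _ ?_ (by simp))), hx, hy, hv'.2.1, hv'.2.2⟩ <;>
    · simp [Finset.insert_subset_iff]
  · obtain ⟨hx, hy, h3, hv'⟩ := hT x y hxy
    have hw : {w} ∈ S := by
      rcases (hKe _ _).1 huw with h' | h'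
      · exact hS.2 _ h' _ (by simp) (by simp)
      · have : w ∈ ({u, v} : Finset V) := h' ▸ by simp
        simp only [Finset.mem_insert, Finset.mem_singleton] at this
        rcases this with rfl | rfl
        exacts [hu, hv]
    refine Relation.ReflTransGen.mono (fun p q hr => ?_) _ _
      (reflTransGen_avoiding_face hS h h3 hv hw hv' (by simp [hwu, hwx, hwy]))
    obtain ⟨hpq, hp, hq⟩ := hr
    simp only [Finset.mem_insert, Finset.mem_singleton, not_or] at hp hq
    exact ⟨(hKe _ _).2 (Or.inl hpq), hp, hq⟩

/-- A complex with an edge that is a maximal face is not homeomorphic to the sphere: two interior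
points of the edge separate it. -/
theorem not_homeomorph_sphere {K : Finset (Finset V)} {u v : V} (huv : u ≠ v)
    (hK : DownClosed (K : Set (Finset V))) (huvK : {u, v} ∈ K)
    (hmax : ∀ σ ∈ K, u ∈ σ → v ∈ σ → σ = {u, v})
    (h : GeomRep K ≃ₜ Metric.sphere (0 : EuclideanSpace ℝ (Fin 3)) 1) : False := by
  have : T1Space (GeomRep K) := GeomRep.isEmbedding_coord.t1Space
  have hcu := GeomRep.continuous_coord (K := K) u
  have hcv := GeomRep.continuous_coord (K := K) v
  have hfin : Set.Finite {x : GeomRep K | (x.coord u = 1 / 3 ∧ 1 / 3 ≤ x.coord v) ∨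
      (x.coord v = 1 / 3 ∧ 1 / 3 ≤ x.coord u)} := by
    have key (x : GeomRep K) (hxu : x.coord u ≠ 0) (hxv : x.coord v ≠ 0) :
        x.coord = Pi.single u (x.coord u) + Pi.single v (1 - x.coord u) := by
      have hsupp := hmax _ x.mem_realization.2.2 (mem_coordSupport.2 hxu) (mem_coordSupport.2 hxv)
      have h0 (w : V) (hwu : w ≠ u) (hwv : w ≠ v) : x.coord w = 0 := by
        by_contra hw
        have : w ∈ coordSupport x.coord := mem_coordSupport.2 hw
        simp [hsupp, hwu, hwv] at this
      have hsum := x.mem_realization.2.1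
      rw [Fintype.sum_eq_add u v huv fun w hw => h0 w hw.1 hw.2] at hsum
      ext w
      by_cases hwu : w = u
      · subst hwu; simp [huv]
      by_cases hwv : w = v
      · subst hwv; simp [hwu]; linarith
      simp [hwu, hwv, h0 w hwu hwv]
    refine Set.Finite.of_finite_image (f := GeomRep.coord)
      (Set.Finite.subset (Set.toFinite
        {Pi.single u (1 / 3 : ℝ) + Pi.single v (1 - 1 / 3),
          Pi.single u (2 / 3 : ℝ) + Pi.single v (1 - 2 / 3)}) ?_)
      GeomRep.isEmbedding_coord.injective.injOn
    rintro _ ⟨x, ⟨h1, h2⟩ | ⟨h1, h2⟩, rfl⟩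
    · have := key x (by rw [h1]; norm_num) (by intro h0; rw [h0] at h2; norm_num at h2)
      rw [h1] at this
      exact Or.inl this
    · have := key x (by intro h0; rw [h0] at h2; norm_num at h2) (by rw [h1]; norm_num)
      have hxu : x.coord u = 2 / 3 := by
        have := congrFun this v
        simp [huv.symm, h1] at this
        linarith
      rw [hxu] at this
      exact Or.inr this
  refine (HasContinuousLogs.of_finite hfin (Y := GeomRep K)).not_separating h
    (U := {x | 1 / 3 < x.coord u ∧ 1 / 3 < x.coord v})
    (W := {x | x.coord u < 1 / 3 ∨ x.coord v < 1 / 3})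
    ?_ ?_ ?_ ?_ ?_ ?_
  · exact (isOpen_lt continuous_const hcu).inter (isOpen_lt continuous_const hcv)
  · exact (isOpen_lt hcu continuous_const).union (isOpen_lt hcv continuous_const)
  · refine Set.disjoint_left.2 ?_
    rintro x ⟨h1, h2⟩ (h3 | h3)
    exacts [lt_asymm h1 h3, lt_asymm h2 h3]
  · ext x
    simp only [Set.mem_ofPred_eq, Set.mem_compl_iff, Set.mem_union]
    grind
  · obtain ⟨x, hx⟩ := GeomRep.exists_of_mem_realization
      (edgePath_mem_realization hK (a := u) (b := v) huvK (t := 1 / 2) (by norm_num))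
    exact ⟨x, by norm_num [hx, edgePath, huv, huv.symm]⟩
  · obtain ⟨x, hx⟩ := GeomRep.exists_single (hK _ huvK {u} (by simp) (by simp))
    exact ⟨x, Or.inr (by simp [hx, huv.symm])⟩

end Sphere

/-- The `d = 1` case of Conjecture 1.3: if `S` is a triangulated `2`-sphere and
`M = {u, v}` is a missing edge of `S`, then `K := S_{≤ 1} ∪ {M}` does not embed in the
`2`-sphere. -/
theorem skeleton_plus_missing_edge_not_embeddable
    {V : Type} [DecidableEq V] [Fintype V]
    (S : Finset (Finset V)) (hS : IsComplex S)
    (hSsphere : Nonempty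
      (GeomRep S ≃ₜ Metric.sphere (0 : EuclideanSpace ℝ (Fin 3)) 1))
    (u v : V) (huv : u ≠ v) (hu : {u} ∈ S) (hv : {v} ∈ S)
    (hM : ({u, v} : Finset V) ∉ S) :
    ¬ ∃ f : GeomRep ((S.filter fun σ => σ.card ≤ 2) ∪ {({u, v} : Finset V)}) →
        Metric.sphere (0 : EuclideanSpace ℝ (Fin 3)) 1,
      Continuous f ∧ Function.Injective f := by
  obtain ⟨h⟩ := hSsphere
  set K := (S.filter fun σ => σ.card ≤ 2) ∪ {({u, v} : Finset V)} with hKdef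
  have hmem (σ : Finset V) : σ ∈ K ↔ (σ ∈ S ∧ σ.card ≤ 2) ∨ σ = {u, v} := by
    simp [hKdef, or_comm]
  have hKd : DownClosed (K : Set (Finset V)) := by
    intro σ hσ τ hτ hne
    simp only [Finset.mem_coe, hmem] at hσ ⊢
    rcases hσ with ⟨hσ, hc⟩ | rfl
    · exact Or.inl ⟨hS.2 σ hσ τ hτ hne, (Finset.card_le_card hτ).trans hc⟩
    · by_cases huτ : u ∈ τ
      · by_cases hvτ : v ∈ τ
        · exact Or.inr (hτ.antisymm (by simp [Finset.insert_subset_iff, huτ, hvτ]))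
        · rw [Finset.pair_comm, Finset.subset_insert_iff_of_notMem hvτ, hne.subset_singleton_iff]
            at hτ
          exact Or.inl ⟨hτ ▸ hu, by simp [hτ]⟩
      · rw [Finset.subset_insert_iff_of_notMem huτ, hne.subset_singleton_iff] at hτ
        exact Or.inl ⟨hτ ▸ hv, by simp [hτ]⟩
  have : CompactSpace (GeomRep K) := GeomRep.compactSpace hKd
  rintro ⟨f, hf, hfinj⟩
  by_cases hsurj : Function.Surjective f
  · refine not_homeomorph_sphere huv hKd ((hmem _).2 (Or.inr rfl)) (fun σ hσ hσu hσv => ?_)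
      (hf.homeoOfEquivCompactToT2 (f := Equiv.ofBijective f ⟨hfinj, hsurj⟩))
    rcases (hmem σ).1 hσ with ⟨hσ, -⟩ | hσ
    · refine absurd (hS.2 σ hσ {u, v} ?_ (by simp)) hM
      simp [Finset.insert_subset_iff, hσu, hσv]
    · exact hσ
  · simp only [Function.Surjective, not_forall, not_exists] at hsurj
    obtain ⟨p, hp⟩ := hsurj
    obtain ⟨φ, ψ, hφ, -, -, -, hψφ⟩ := exists_sphere_chart p
    have hG : Continuous fun x => φ (f x) := hφ.comp_continuous hf hp
    have hGinj : Function.Injective fun x => φ (f x) := fun x y hxy => hfinj <| by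
      rw [← hψφ _ (hp x), ← hψφ _ (hp y)]
      exact congrArg ψ hxy
    have hext := GeomRep.isEmbedding_coord.injective.extend_apply (fun x => φ (f x)) 0
    refine not_injOn_plane hS h huv hu hv hM hKd (fun a b => ?_)
      (F := Function.extend GeomRep.coord (fun x => φ (f x)) 0) ?_ ?_
    · simp only [Finset.mem_coe, hmem, Finset.card_le_two, and_true]
    · rw [← GeomRep.image_coord_univ, GeomRep.isEmbedding_coord.isInducing.continuousOn_image_iff]
      exact (hG.congr fun x => (hext x).symm).continuousOn
    · rw [← GeomRep.image_coord_univ]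
      rintro _ ⟨x, -, rfl⟩ _ ⟨y, -, rfl⟩ hxy
      rw [hext, hext] at hxy
      rw [hGinj hxy]
end

section
/- Let d ≥ 1, let 1 ≤ q ≤ 2d−1 and p = 2d − q. Let S be an abstract simplicial complex of dimension 2d, let A be a p-dimensional face of S (|A| = p+1), and let B be a (q+1)-element vertex set with B ∉ S such that the link lk(A,S) = {ρ ∈ S : ρ ∩ A = ∅ and ρ ∪ A ∈ S} equals ∂B, the set of nonempty proper subsets of B. Let S' := (S ∖ {ρ ∈ S : A ⊆ ρ}) ∪ {α ∪ β : α ⊊ A, β ⊆ B, α ∪ β ≠ ∅} be the result of the bistellar move of type (p,q). Suppose M is a missing d-face of S' but not a missing d-face of S. Then either p = q = d and M = A, or q = d−1 and M = {v₀} ∪ B for some vertex v₀ ∉ A ∪ B. -/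
/-- `M` is a missing `d`-face of the complex `K`: `|M| = d + 1`, `M ∉ K`, and every
nonempty proper subset of `M` is a face of `K`. -/
def IsMissingFace {V : Type} [DecidableEq V] (K : Finset (Finset V)) (d : ℕ)
    (M : Finset V) : Prop :=
  M.card = d + 1 ∧ M ∉ K ∧ ∀ τ : Finset V, τ ⊂ M → τ.Nonempty → τ ∈ K

/-- The combinatorial claim in the proof of Theorem 1.2: if `S'` arises from the
`2d`-dimensional complex `S` by a bistellar move of type `(p, q)` (removing the star of
the `p`-face `A`, whose link is the boundary of the `(q+1)`-element non-face `B`), and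
`M` is a missing `d`-face of `S'` but not of `S`, then either `p = q = d` and `M = A`,
or `q = d - 1` and `M = {v₀} ∪ B` for some vertex `v₀ ∉ A ∪ B`. -/
theorem missing_face_after_bistellar_move
    {V : Type} [DecidableEq V]
    (d p q : ℕ) (hd : 1 ≤ d) (hq : 1 ≤ q) (hp : 1 ≤ p) (hpq : p + q = 2 * d)
    (S : Finset (Finset V)) (hS : IsComplex S)
    (hSdim : (∀ σ ∈ S, σ.card ≤ 2 * d + 1) ∧ ∃ σ ∈ S, σ.card = 2 * d + 1)
    (A : Finset V) (hA : A ∈ S) (hcardA : A.card = p + 1)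
    (B : Finset V) (hcardB : B.card = q + 1) (hB : B ∉ S)
    (hlink : ∀ ρ : Finset V, (ρ ∈ S ∧ Disjoint ρ A ∧ ρ ∪ A ∈ S) ↔ (ρ.Nonempty ∧ ρ ⊂ B))
    (S' : Finset (Finset V))
    (hS' : ∀ ρ : Finset V, ρ ∈ S' ↔
      ((ρ ∈ S ∧ ¬ A ⊆ ρ) ∨ (ρ.Nonempty ∧ ∃ α β : Finset V, α ⊂ A ∧ β ⊆ B ∧ ρ = α ∪ β)))
    (M : Finset V) (hM : IsMissingFace S' d M) (hMS : ¬ IsMissingFace S d M) :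
    (p = d ∧ q = d ∧ M = A) ∨
    (q + 1 = d ∧ ∃ v₀ : V, v₀ ∉ A ∪ B ∧ M = insert v₀ B) := by
  obtain ⟨hMcard, hMS', hMsub⟩ := hM
  have hAB : Disjoint A B := by
    rw [Finset.disjoint_right]
    intro b hb
    have hbB : ({b} : Finset V) ⊂ B := by
      refine (Finset.singleton_subset_iff.2 hb).ssubset_of_ne ?_
      rintro rfl
      rw [Finset.card_singleton] at hcardB
      omega
    exact Finset.disjoint_singleton_left.1
      ((hlink {b}).2 ⟨Finset.singleton_nonempty b, hbB⟩).2.1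
  have hAne : A.Nonempty := hS.1 A hA
  have hBne : B.Nonempty := Finset.card_pos.1 (by omega)
  by_cases hM : M ∈ S
  · left
    have hAM : A ⊆ M := by
      by_contra h
      exact hMS' ((hS' M).2 (Or.inl ⟨hM, h⟩))
    have hMA : M = A := by
      by_contra hne
      rcases (hS' A).1 (hMsub A (hAM.ssubset_of_ne (Ne.symm hne)) hAne) with
        h | ⟨-, α, β, hα, hβ, h⟩
      · exact h.2 subset_rfl
      · exact hα.2 (Disjoint.left_le_of_le_sup_right h.le (hAB.mono_right hβ))
    rw [hMA, hcardA] at hMcard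
    exact ⟨by omega, by omega, hMA⟩
  · right
    obtain ⟨τ, hτM, hτne, hτS⟩ : ∃ τ, τ ⊂ M ∧ τ.Nonempty ∧ τ ∉ S := by
      by_contra! h
      exact hMS ⟨hMcard, hM, h⟩
    have hBτ : B ⊆ τ := by
      rcases (hS' τ).1 (hMsub τ hτM hτne) with h | ⟨-, α, β, hα, hβ, rfl⟩
      · exact absurd h.1 hτS
      · rcases hβ.eq_or_ssubset with rfl | hβ
        · exact Finset.subset_union_right
        · exfalso
          rcases β.eq_empty_or_nonempty with rfl | hβne
          · exact hτS (hS.2 A hA _ (by simpa using hα.1) hτne)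
          · exact hτS (hS.2 _ ((hlink β).2 ⟨hβne, hβ⟩).2.2 _
              (Finset.union_comm α β ▸ Finset.union_subset_union_right hα.1) hτne)
    have hBM : B ⊂ M := hBτ.trans_ssubset hτM
    have hMBcard : (M \ B).card + (q + 1) = d + 1 := by
      rw [← hcardB, ← hMcard, Finset.card_sdiff_add_card_eq_card hBM.1]
    obtain ⟨v₀, hv₀, hvA⟩ : ∃ v ∈ M \ B, v ∉ A := by
      by_contra! h
      refine hMS' ((hS' M).2 (Or.inr ⟨hτne.mono hτM.1, M \ B, B, ⟨h, fun hA' => ?_⟩,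
        subset_rfl, (Finset.sdiff_union_of_subset hBM.1).symm⟩))
      have := Finset.card_le_card hA'
      omega
    obtain ⟨hvM, hvB⟩ := Finset.mem_sdiff.1 hv₀
    have hvAB : v₀ ∉ A ∪ B := by simp [hvA, hvB]
    have hMv : M = insert v₀ B := by
      by_contra hne
      have hsub : insert v₀ B ⊂ M :=
        (Finset.insert_subset hvM hBM.1).ssubset_of_ne (Ne.symm hne)
      rcases (hS' _).1 (hMsub _ hsub (Finset.insert_nonempty v₀ B)) with
        h | ⟨-, α, β, hα, hβ, h⟩
      · exact hB (hS.2 _ h.1 B (Finset.subset_insert v₀ B) hBne)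
      · exact hvAB (Finset.union_subset_union hα.1 hβ (h ▸ Finset.mem_insert_self v₀ B))
    rw [hMv, Finset.card_insert_of_notMem hvB, hcardB] at hMcard
    exact ⟨by omega, v₀, hvAB, hMv⟩
end
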